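/- arXiv:2403.16027 — 17 statements merged into one kernel-verified Lean document; each statement's English description precedes it below -/
import Mathlib

section
/- Fin is a non-regular subobject of Baire space: there is no function s : (ℕ → ℕ) → ℕ that is continuous on the subspace F = {x : ℕ → ℕ | ∃ n, ∀ m ≥ n, x m = 0} (with the subspace topology from Baire space) and satisfies: for every x ∈ F and every m ≥ s x, x m = 0. -/
/-- The standard unit sequences converge to zero in a countable power. -/
theorem tendsto_pi_single_atTop_zero {M : Type*} [Zero M] [TopologicalSpace M] (a : M) :
    Filter.Tendsto (fun k : ℕ => (Pi.single k a : ℕ → M)) Filter.atTop (nhds 0) := by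
  refine tendsto_pi_nhds.2 fun i => tendsto_const_nhds.congr' ?_
  filter_upwards [Filter.eventually_gt_atTop i] with k hk
  simp [Pi.single_eq_of_ne hk.ne]

/-- `Fin` is a non-regular subobject of Baire space: there is no continuous witness
selector on the set of eventually-zero sequences. -/
theorem fin_not_regular :
    ¬ ∃ s : (ℕ → ℕ) → ℕ,
      ContinuousOn s {x : ℕ → ℕ | ∃ n : ℕ, ∀ m ≥ n, x m = 0} ∧
      ∀ x ∈ {x : ℕ → ℕ | ∃ n : ℕ, ∀ m ≥ n, x m = 0}, ∀ m ≥ s x, x m = 0 := by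
  rintro ⟨s, hs, hw⟩
  have hmem (k : ℕ) : (Pi.single k 1 : ℕ → ℕ) ∈ {x : ℕ → ℕ | ∃ n : ℕ, ∀ m ≥ n, x m = 0} :=
    ⟨k + 1, fun m hm => Pi.single_eq_of_ne (by omega) 1⟩
  have hlim := (hs 0 ⟨0, fun _ _ => rfl⟩).tendsto.comp
    (tendsto_nhdsWithin_iff.2 ⟨tendsto_pi_single_atTop_zero 1, .of_forall hmem⟩)
  rw [nhds_discrete, Filter.tendsto_pure] at hlim
  obtain ⟨k, hk, hle⟩ := (hlim.and (Filter.eventually_ge_atTop (s 0))).exists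
  have hzero := hw _ (hmem k) k (hk.trans_le hle)
  simp at hzero
end

section
/- Let C = {(x,y) ∈ (ℕ → ℕ) × (ℕ → ℕ) | x = 0^∞ ∨ y = 0^∞}, with the subspace topology from the product of two copies of Baire space, where 0^∞ denotes the constant-zero sequence. There is no function r : C → Bool, continuous on C, such that for every (x,y) ∈ C: r (x,y) = false implies x = 0^∞, and r (x,y) = true implies y = 0^∞. (Hence the witnessed union L of two closed subobjects of Baire space × Baire space is not regular, and in particular a union of two Π⁰₁ subobjects need not be Π⁰₂.) -/
open Filter Topology in
theorem tendsto_pi_single_atTop_zero_s1 :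
    Tendsto (fun n : ℕ => (Pi.single n 1 : ℕ → ℕ)) atTop (𝓝 fun _ => 0) := by
  refine tendsto_pi_nhds.2 fun k => tendsto_const_nhds.congr' ?_
  filter_upwards [eventually_gt_atTop k] with n hn
  simp [hn.ne]

theorem pi_single_one_ne_zero (n : ℕ) : (Pi.single n 1 : ℕ → ℕ) ≠ fun _ => 0 := fun h => by
  simpa using congrFun h n

open Filter Topology in
/-- A function to `Bool` that is continuous on `s` and constant along a sequence in `s` takes
the same value at the limit of the sequence. -/
theorem ContinuousOn.eq_bool_of_tendsto {X : Type*} [TopologicalSpace X] {r : X → Bool}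
    {s : Set X} (hr : ContinuousOn r s) {u : ℕ → X} {x : X} (hx : x ∈ s) (hu : ∀ n, u n ∈ s)
    (hux : Tendsto u atTop (𝓝 x)) {b : Bool} (hb : ∀ n, r (u n) = b) : r x = b :=
  tendsto_nhds_unique
    ((hr x hx).tendsto.comp (tendsto_nhdsWithin_iff.2 ⟨hux, .of_forall hu⟩))
    (tendsto_const_nhds.congr fun n => (hb n).symm)

/-- The witnessed union `L` of two closed subobjects of Baire space × Baire space is
not regular: there is no continuous witness selector on
`C = {(x,y) | x = 0^∞ ∨ y = 0^∞}`. -/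
theorem L_not_regular :
    ¬ ∃ r : (ℕ → ℕ) × (ℕ → ℕ) → Bool,
      ContinuousOn r {p : (ℕ → ℕ) × (ℕ → ℕ) | p.1 = (fun _ => 0) ∨ p.2 = (fun _ => 0)} ∧
      ∀ p ∈ {p : (ℕ → ℕ) × (ℕ → ℕ) | p.1 = (fun _ => 0) ∨ p.2 = (fun _ => 0)},
        (r p = false → p.1 = fun _ => 0) ∧ (r p = true → p.2 = fun _ => 0) := by
  rintro ⟨r, hr, h⟩
  have hfalse : r (fun _ => 0, fun _ => 0) = false :=
    hr.eq_bool_of_tendsto (u := fun n => (fun _ => 0, Pi.single n 1)) (.inl rfl)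
      (fun _ => .inl rfl) (tendsto_const_nhds.prodMk_nhds tendsto_pi_single_atTop_zero_s1)
      fun n => Bool.eq_false_iff.2 fun hn => pi_single_one_ne_zero n ((h _ (.inl rfl)).2 hn)
  have htrue : r (fun _ => 0, fun _ => 0) = true :=
    hr.eq_bool_of_tendsto (u := fun n => (Pi.single n 1, fun _ => 0)) (.inl rfl)
      (fun _ => .inr rfl) (tendsto_pi_single_atTop_zero_s1.prodMk_nhds tendsto_const_nhds)
      fun n => Bool.eq_true_of_not_eq_false fun hn =>
        pi_single_one_ne_zero n ((h _ (.inr rfl)).1 hn)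
  exact Bool.false_ne_true (hfalse.symm.trans htrue)
end

section
/- L is not many-one (Levin) reducible to Fin: L ≰ₘ Fin. Consequently, Fin is not many-one (Levin) complete among Σ⁰₂ witnessed subsets, since L is a witnessed union of two closed (Π⁰₁) subobjects. -/
/-- Many-one (Levin) reducibility between witnessed sets. -/
def ManyOneRed {X Y WA WB : Type*} [TopologicalSpace X] [TopologicalSpace Y]
    [TopologicalSpace WA] [TopologicalSpace WB]
    (A : WA → X → Prop) (B : WB → Y → Prop) : Prop :=
  ∃ (φ : X → Y) (rm : WA × X → WB) (rp : WB × X → WA),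
    Continuous φ ∧
    ContinuousOn rm {p : WA × X | A p.1 p.2} ∧
    ContinuousOn rp {p : WB × X | (∃ w, A w p.2) ∧ B p.1 (φ p.2)} ∧
    (∀ x, (∃ w, A w x) ↔ (∃ v, B v (φ x))) ∧
    (∀ w x, A w x → B (rm (w, x)) (φ x)) ∧
    (∀ v x, (∃ w, A w x) → B v (φ x) → A (rp (v, x)) x)

/-- The witnessed set `Fin` of eventually-zero sequences, with witness type ℕ. -/
def FinW (n : ℕ) (x : ℕ → ℕ) : Prop := ∀ m ≥ n, x m = 0

/-- The witnessed union `L` of two closed sets, with witness type `Bool`. -/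
def LW (w : Bool) (p : (ℕ → ℕ) × (ℕ → ℕ)) : Prop :=
  match w with
  | false => p.1 = fun _ => 0
  | true => p.2 = fun _ => 0

open Filter Topology

/-- A map to a discrete space that is continuous on `s` is eventually constant along sequences
in `s` that converge in `s`. -/
theorem ContinuousOn.eventually_eq_of_tendsto {X Y ι : Type*} [TopologicalSpace X]
    [TopologicalSpace Y] [DiscreteTopology Y] {f : X → Y} {s : Set X} (hf : ContinuousOn f s)
    {l : Filter ι} {u : ι → X} {x : X} (hx : x ∈ s) (hu : Tendsto u l (𝓝 x))
    (hus : ∀ᶠ i in l, u i ∈ s) : ∀ᶠ i in l, f (u i) = f x := by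
  have h := (hf x hx).tendsto.comp (tendsto_nhdsWithin_iff.2 ⟨hu, hus⟩)
  rw [nhds_discrete, tendsto_pure] at h
  exact h

theorem tendsto_single_one_nhds_zero :
    Tendsto (fun k : ℕ => (Pi.single k 1 : ℕ → ℕ)) atTop (𝓝 fun _ => 0) := by
  rw [tendsto_pi_nhds]
  intro i
  refine tendsto_const_nhds.congr' ?_
  filter_upwards [eventually_gt_atTop i] with k hk
  simp [hk.ne]

theorem single_one_ne_zero (k : ℕ) : (Pi.single k 1 : ℕ → ℕ) ≠ fun _ => 0 := fun h => by
  simpa using congrFun h k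

theorem FinW.mono {m n : ℕ} {x : ℕ → ℕ} (h : FinW m x) (hmn : m ≤ n) : FinW n x :=
  fun k hk => h k (hmn.trans hk)

/-- `L` is not many-one (Levin) reducible to `Fin`; hence `Fin` is not many-one
(Levin) complete among Σ⁰₂ witnessed subsets. -/
theorem L_not_manyOneRed_fin : ¬ ManyOneRed LW FinW := by
  rintro ⟨φ, rm, rp, -, hrm, hrp, -, hm, hp⟩
  let o : ℕ → ℕ := fun _ => 0
  let e : ℕ → ℕ → ℕ := fun k => Pi.single k 1
  have he : Tendsto e atTop (𝓝 o) := tendsto_single_one_nhds_zero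
  have hl : Tendsto (fun k => (o, e k)) atTop (𝓝 (o, o)) := tendsto_const_nhds.prodMk_nhds he
  have hr : Tendsto (fun k => (e k, o)) atTop (𝓝 (o, o)) := he.prodMk_nhds tendsto_const_nhds
  have Ll (y : ℕ → ℕ) : LW false (o, y) := rfl
  have Lr (x : ℕ → ℕ) : LW true (x, o) := rfl
  have hml := hrm.eventually_eq_of_tendsto (x := (false, (o, o))) (Ll o)
    (tendsto_const_nhds.prodMk_nhds hl) (.of_forall fun k => Ll (e k))
  have hmr := hrm.eventually_eq_of_tendsto (x := (true, (o, o))) (Lr o)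
    (tendsto_const_nhds.prodMk_nhds hr) (.of_forall fun k => Lr (e k))
  let N := max (rm (false, (o, o))) (rm (true, (o, o)))
  have hFo : FinW N (φ (o, o)) := (hm _ _ (Ll o)).mono (le_max_left _ _)
  have hFl : ∀ᶠ k in atTop, FinW N (φ (o, e k)) := by
    filter_upwards [hml] with k hk
    exact (hm _ _ (Ll (e k))).mono (hk.trans_le (le_max_left _ _))
  have hFr : ∀ᶠ k in atTop, FinW N (φ (e k, o)) := by
    filter_upwards [hmr] with k hk
    exact (hm _ _ (Lr (e k))).mono (hk.trans_le (le_max_right _ _))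
  have hpl := hrp.eventually_eq_of_tendsto (x := (N, (o, o))) ⟨⟨false, Ll o⟩, hFo⟩
    (tendsto_const_nhds.prodMk_nhds hl) (hFl.mono fun k hk => ⟨⟨false, Ll (e k)⟩, hk⟩)
  have hpr := hrp.eventually_eq_of_tendsto (x := (N, (o, o))) ⟨⟨false, Ll o⟩, hFo⟩
    (tendsto_const_nhds.prodMk_nhds hr) (hFr.mono fun k hk => ⟨⟨true, Lr (e k)⟩, hk⟩)
  obtain ⟨k, hkl, hkr, hkFl, hkFr⟩ := (hpl.and (hpr.and (hFl.and hFr))).exists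
  have hwl := hp _ _ ⟨false, Ll (e k)⟩ hkFl
  have hwr := hp _ _ ⟨true, Lr (e k)⟩ hkFr
  rw [hkl] at hwl
  rw [hkr] at hwr
  cases hb : rp (N, (o, o)) with
  | false => rw [hb] at hwr; exact single_one_ne_zero k hwr
  | true => rw [hb] at hwl; exact single_one_ne_zero k hwl
end

section
/- Let k ∈ ℕ and let C : Fin k → Set (ℕ → ℕ) be a finite family of closed subsets of Baire space, and let A be the 'almost Π⁰₁' witnessed set on Baire space with witness type Fin k defined by A i x ↔ x ∈ C i. Let B be an amalgamable witnessed set on Baire space with witness type ℕ. If A ≤ₘ B, then A is regular: there is a function s : (ℕ → ℕ) → Fin k, continuous on the subspace ⋃ i, C i, such that x ∈ C (s x) for every x ∈ ⋃ i, C i. -/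
/-- A witnessed set is amalgamable if finitely many witness candidates, at least
one of which is correct, can be continuously amalgamated into a correct witness. -/
def Amalgamable {X W : Type*} [TopologicalSpace X] [TopologicalSpace W]
    (A : W → X → Prop) : Prop :=
  ∃ F : List W × X → W,
    ContinuousOn F {p : List W × X | ∃ w, A w p.2} ∧
    ∀ (l : List W) (x : X), (∃ w, A w x) → (∃ w ∈ l, A w x) → A (F (l, x)) x

open Filter Topology in
/-- If a finite witnessed union of closed sets reduces to an amalgamable witnessed set with
discrete witnesses, then near each point of the union a single witness is valid throughout. -/
theorem exists_eventually_mem_of_manyOneRed_amalgamable {X Y ι W : Type*} [TopologicalSpace X]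
    [TopologicalSpace Y] [Finite ι] [TopologicalSpace ι] [DiscreteTopology ι]
    [TopologicalSpace W] [DiscreteTopology W] {C : ι → Set X} (hC : ∀ i, IsClosed (C i))
    {B : W → Y → Prop} (hB : Amalgamable B)
    (hred : ManyOneRed (fun (i : ι) (x : X) => x ∈ C i) B) {x : X} (hx : x ∈ ⋃ i, C i) :
    ∃ i, ∀ᶠ y in 𝓝[⋃ i, C i] x, y ∈ C i := by
  classical
  have := Fintype.ofFinite ι
  obtain ⟨F, hFc, hF⟩ := hB
  obtain ⟨φ, rm, rp, hφ, hrm, hrp, hiff, hm, hp⟩ := hred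
  have hmem : ∀ y, y ∈ ⋃ i, C i ↔ ∃ i, y ∈ C i := fun y => Set.mem_iUnion
  set l : List W := (Finset.univ.toList : List ι).map fun i => rm (i, x) with hl
  have hwit : ∀ i, ∀ᶠ y in 𝓝 x, y ∈ C i → B (rm (i, x)) (φ y) := by
    intro i
    by_cases hi : x ∈ C i
    · have hc : ContinuousWithinAt (fun y => rm (i, y)) (C i) x :=
        (hrm (i, x) hi).comp (f := fun y => (i, y)) (by fun_prop) fun y hy => hy
      have he : ∀ᶠ y in 𝓝[C i] x, rm (i, y) = rm (i, x) :=
        hc.eventually ((isOpen_discrete {rm (i, x)}).mem_nhds rfl)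
      filter_upwards [eventually_nhdsWithin_iff.1 he] with y hy hyi
      exact hy hyi ▸ hm i y hyi
    · filter_upwards [(hC i).isOpen_compl.mem_nhds hi] with y hy hyi
      exact absurd hyi hy
  have hFx : ∀ᶠ y in 𝓝[⋃ i, C i] x, F (l, φ y) = F (l, φ x) := by
    have hc : ContinuousWithinAt (fun y => F (l, φ y)) (⋃ i, C i) x :=
      (hFc (l, φ x) ((hiff x).1 ((hmem x).1 hx))).comp (f := fun y => (l, φ y))
        (by fun_prop) fun y hy => (hiff y).1 ((hmem y).1 hy)
    exact hc.eventually ((isOpen_discrete {F (l, φ x)}).mem_nhds rfl)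
  set v := F (l, φ x)
  have hv : ∀ᶠ y in 𝓝[⋃ i, C i] x, B v (φ y) := by
    filter_upwards [hFx, nhdsWithin_le_nhds (eventually_all.2 hwit), self_mem_nhdsWithin]
      with y hy hw hyC
    obtain ⟨i, hi⟩ := (hmem y).1 hyC
    rw [← hy]
    exact hF l (φ y) ((hiff y).1 ⟨i, hi⟩) ⟨rm (i, x), by simp [hl], hw i hi⟩
  have hc : ContinuousWithinAt (fun y => rp (v, y)) {y | (∃ i, y ∈ C i) ∧ B v (φ y)} x :=
    (hrp (v, x) ⟨(hmem x).1 hx, hv.self_of_nhdsWithin hx⟩).comp (f := fun y => (v, y))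
      (by fun_prop) fun y hy => hy
  have he : ∀ᶠ y in 𝓝[{y | (∃ i, y ∈ C i) ∧ B v (φ y)}] x, rp (v, y) = rp (v, x) :=
    hc.eventually ((isOpen_discrete {rp (v, x)}).mem_nhds rfl)
  refine ⟨rp (v, x), ?_⟩
  filter_upwards [hv, nhdsWithin_le_nhds (eventually_nhdsWithin_iff.1 he), self_mem_nhdsWithin]
    with y hy hey hyC
  have hy' := (hmem y).1 hyC
  exact hey ⟨hy', hy⟩ ▸ hp v y hy' hy

open Filter Topology in
/-- On a subset of a countable product of discrete spaces, a choice which can locally be made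
constant can be made continuously. -/
theorem exists_continuousOn_selection_of_eventually {E : ℕ → Type*}
    [∀ n, TopologicalSpace (E n)] [∀ n, DiscreteTopology (E n)] {ι : Type*} [TopologicalSpace ι]
    [Nonempty ι] {U : Set (∀ n, E n)} {C : ι → Set (∀ n, E n)}
    (h : ∀ x ∈ U, ∃ i, ∀ᶠ y in 𝓝[U] x, y ∈ C i) :
    ∃ s : (∀ n, E n) → ι, ContinuousOn s U ∧ ∀ x ∈ U, x ∈ C (s x) := by
  classical
  have hcyl : ∀ x ∈ U, ∃ n, ∃ i, U ∩ PiNat.cylinder x n ⊆ C i := by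
    intro x hx
    obtain ⟨i, hi⟩ := h x hx
    obtain ⟨O, hO, hxO, hsub⟩ := mem_nhdsWithin.1 hi
    obtain ⟨_, ⟨z, n, rfl⟩, hxz, hzO⟩ :=
      (PiNat.isTopologicalBasis_cylinders E).exists_subset_of_mem_open hxO hO
    rw [← PiNat.mem_cylinder_iff_eq.1 hxz] at hzO
    exact ⟨n, i, fun y hy => hsub ⟨hzO hy.2, hy.1⟩⟩
  have hg : ∀ S : Set (∀ n, E n), ∃ i, (∃ j, U ∩ S ⊆ C j) → U ∩ S ⊆ C i := by
    intro S
    by_cases hS : ∃ j, U ∩ S ⊆ C j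
    · exact hS.imp fun _ hj _ => hj
    · exact ⟨Classical.arbitrary ι, fun hS' => absurd hS' hS⟩
  choose g hg using hg
  let N : (∀ n, E n) → Set ℕ := fun x => {n | ∃ i, U ∩ PiNat.cylinder x n ⊆ C i}
  have hN : ∀ x ∈ U, sInf (N x) ∈ N x := fun x hx => Nat.sInf_mem (hcyl x hx)
  have hconst : ∀ x ∈ U, ∀ y ∈ U, y ∈ PiNat.cylinder x (sInf (N x)) →
      PiNat.cylinder y (sInf (N y)) = PiNat.cylinder x (sInf (N x)) := by
    intro x hx y hy hyx
    have heq : ∀ m ≤ sInf (N x), PiNat.cylinder y m = PiNat.cylinder x m := fun m hm =>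
      PiNat.mem_cylinder_iff_eq.1 (PiNat.cylinder_anti x hm hyx)
    have hle : sInf (N y) ≤ sInf (N x) := Nat.sInf_le (by
      change ∃ i, U ∩ PiNat.cylinder y _ ⊆ C i
      rw [heq _ le_rfl]
      exact hN x hx)
    have hge : sInf (N x) ≤ sInf (N y) := Nat.sInf_le (by
      change ∃ i, U ∩ PiNat.cylinder x _ ⊆ C i
      rw [← heq _ hle]
      exact hN y hy)
    rw [hle.antisymm hge, heq _ le_rfl]
  refine ⟨fun x => g (PiNat.cylinder x (sInf (N x))), fun x hx => ?_, fun x hx =>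
    hg _ (hN x hx) ⟨hx, PiNat.self_mem_cylinder x _⟩⟩
  have hev : ∀ᶠ y in 𝓝[U] x, g (PiNat.cylinder y (sInf (N y))) =
      g (PiNat.cylinder x (sInf (N x))) := by
    filter_upwards [self_mem_nhdsWithin, nhdsWithin_le_nhds
      ((PiNat.isOpen_cylinder E x (sInf (N x))).mem_nhds (PiNat.self_mem_cylinder x _))]
      with y hy hyx
    rw [hconst x hx y hy hyx]
  exact continuousWithinAt_const.congr_of_eventuallyEq hev rfl

/-- If an almost Π⁰₁ witnessed set (a finite witnessed union of closed sets) is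
many-one reducible to an amalgamable witnessed set, then it is regular. -/
theorem almostPi01_manyOneRed_amalgamable_regular
    (k : ℕ) (C : Fin k → Set (ℕ → ℕ)) (hC : ∀ i, IsClosed (C i))
    (B : ℕ → (ℕ → ℕ) → Prop) (hB : Amalgamable B)
    (hred : ManyOneRed (fun (i : Fin k) (x : ℕ → ℕ) => x ∈ C i) B) :
    ∃ s : (ℕ → ℕ) → Fin k,
      ContinuousOn s (⋃ i, C i) ∧ ∀ x ∈ ⋃ i, C i, x ∈ C (s x) := by
  have : Nonempty (Fin k) := by
    obtain ⟨_, _, rp, _⟩ := hred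
    exact ⟨rp (0, 0)⟩
  exact exists_continuousOn_selection_of_eventually fun x hx =>
    exists_eventually_mem_of_manyOneRed_amalgamable hC hB hred hx
end

section
/- Every Σ⁰₂ witnessed subset of Baire space is demi-many-one reducible to Fin: for every closed set B ⊆ ℕ × (ℕ → ℕ), there exist a continuous map φ : (ℕ → ℕ) → (ℕ → ℕ) and a map r₊ : ℕ × (ℕ → ℕ) → ℕ, continuous on the subspace {(s,x) | x ∈ |A_B| ∧ ∀ m ≥ s, (φ x) m = 0}, such that: (i) for every x, (∃ n, (n,x) ∈ B) ↔ (∃ s, ∀ m ≥ s, (φ x) m = 0); and (ii) whenever x ∈ |A_B| and ∀ m ≥ s, (φ x) m = 0, then (r₊ (s,x), x) ∈ B. -/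
open PiNat in
/-- The least `n` which is at least `m`, or whose section of `B` meets the cylinder of length `m`
around `x`. -/
noncomputable def leastCandidate (B : Set (ℕ × (ℕ → ℕ))) (m : ℕ) (x : ℕ → ℕ) : ℕ :=
  sInf {n | m ≤ n ∨ ∃ y ∈ cylinder x m, (n, y) ∈ B}

theorem leastCandidate_spec (B : Set (ℕ × (ℕ → ℕ))) (m : ℕ) (x : ℕ → ℕ) :
    m ≤ leastCandidate B m x ∨ ∃ y ∈ PiNat.cylinder x m, (leastCandidate B m x, y) ∈ B :=
  Nat.sInf_mem (s := {n | m ≤ n ∨ ∃ y ∈ PiNat.cylinder x m, (n, y) ∈ B}) ⟨m, Or.inl le_rfl⟩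

theorem leastCandidate_mono (B : Set (ℕ × (ℕ → ℕ))) (x : ℕ → ℕ) :
    Monotone fun m => leastCandidate B m x := by
  intro m m' h
  refine Nat.sInf_le ?_
  rcases leastCandidate_spec B m' x with h' | ⟨y, hy, hB⟩
  · exact Or.inl (h.trans h')
  · exact Or.inr ⟨y, PiNat.cylinder_anti x h hy, hB⟩

theorem leastCandidate_le {B : Set (ℕ × (ℕ → ℕ))} {n : ℕ} {x : ℕ → ℕ} (h : (n, x) ∈ B) (m : ℕ) :
    leastCandidate B m x ≤ n :=
  Nat.sInf_le (Or.inr ⟨x, PiNat.self_mem_cylinder x m, h⟩)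

theorem continuous_leastCandidate (B : Set (ℕ × (ℕ → ℕ))) (m : ℕ) :
    Continuous (leastCandidate B m) := by
  refine IsLocallyConstant.continuous ((IsLocallyConstant.iff_exists_open _).2 fun x =>
    ⟨PiNat.cylinder x m, PiNat.isOpen_cylinder _ x m, PiNat.self_mem_cylinder x m, ?_⟩)
  intro y hy
  simp only [leastCandidate, PiNat.mem_cylinder_iff_eq.1 hy]

/-- If the least candidates stabilize, then their limit is a witness. -/
theorem leastCandidate_mem {B : Set (ℕ × (ℕ → ℕ))} (hB : IsClosed B) {s : ℕ} {x : ℕ → ℕ}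
    (h : ∀ m ≥ s, leastCandidate B m x = leastCandidate B s x) :
    (leastCandidate B s x, x) ∈ B := by
  by_contra hx
  set n := leastCandidate B s x with hn
  have hC : IsClosed {y | (n, y) ∈ B} := hB.preimage (by fun_prop)
  obtain ⟨k, hk⟩ := PiNat.exists_disjoint_cylinder hC (x := x) hx
  let m := max (max s k) (n + 1)
  have hm : leastCandidate B m x = n := h m (by simp only [m]; omega)
  rcases leastCandidate_spec B m x with h' | ⟨y, hy, hy'⟩
  · simp only [hm, m] at h'
    omega
  · rw [hm] at hy'
    exact Set.disjoint_left.1 hk hy'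
      (PiNat.cylinder_anti x (show k ≤ m by simp only [m]; omega) hy)


/-- Every Σ⁰₂ witnessed subset of Baire space is demi-many-one reducible to `Fin`. -/
theorem sigma02_demi_manyOneRed_fin (B : Set (ℕ × (ℕ → ℕ))) (hB : IsClosed B) :
    ∃ (φ : (ℕ → ℕ) → (ℕ → ℕ)) (rp : ℕ × (ℕ → ℕ) → ℕ),
      Continuous φ ∧
      ContinuousOn rp
        {p : ℕ × (ℕ → ℕ) | (∃ n, (n, p.2) ∈ B) ∧ ∀ m ≥ p.1, φ p.2 m = 0} ∧
      (∀ x, (∃ n, (n, x) ∈ B) ↔ ∃ s : ℕ, ∀ m ≥ s, φ x m = 0) ∧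
      (∀ (s : ℕ) (x : ℕ → ℕ), (∃ n, (n, x) ∈ B) → (∀ m ≥ s, φ x m = 0) →
        (rp (s, x), x) ∈ B) := by
  have stable : ∀ (s : ℕ) (x : ℕ → ℕ),
      (∀ m ≥ s, leastCandidate B (m + 1) x - leastCandidate B m x = 0) →
        (leastCandidate B s x, x) ∈ B := by
    intro s x h
    refine leastCandidate_mem hB fun m hm => ?_
    induction m, hm using Nat.le_induction with
    | base => rfl
    | succ m hm ih =>
      have h₁ : leastCandidate B m x ≤ leastCandidate B (m + 1) x :=
        leastCandidate_mono B x m.le_succ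
      have h₂ := h m hm
      omega
  refine ⟨fun x m => leastCandidate B (m + 1) x - leastCandidate B m x,
    fun p => leastCandidate B p.1 p.2, ?_, ?_, ?_, fun s x _ h => stable s x h⟩
  · exact continuous_pi fun m =>
      (continuous_leastCandidate B (m + 1)).sub (continuous_leastCandidate B m)
  · exact (continuous_prod_of_discrete_left.2 (continuous_leastCandidate B)).continuousOn
  · refine fun x => ⟨fun ⟨n, hn⟩ => ?_, fun ⟨s, hs⟩ => ⟨_, stable s x hs⟩⟩
    obtain ⟨s, hs⟩ := converges_of_monotone_of_bounded (leastCandidate_mono B x)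
      (leastCandidate_le hn)
    obtain ⟨N, hN⟩ := hs
    exact ⟨N, fun m hm => by simp [hN m hm, hN (m + 1) (by omega)]⟩
end

section
/- Fin is many-one (Levin) complete among Σ⁰₂ witnessed subsets of Baire space having the unique witness property: for every closed set B ⊆ ℕ × (ℕ → ℕ) whose sections are pairwise disjoint (i.e., if n ≠ m then there is no x with both (n,x) ∈ B and (m,x) ∈ B), the associated witnessed set A_B satisfies A_B ≤ₘ Fin. -/
section UniqueWitness

open Topology Filter

/-- The first `s` entries of `x` rule out that `m` is a witness for `x`. -/
def RefutedAt (B : Set (ℕ × (ℕ → ℕ))) (m s : ℕ) (x : ℕ → ℕ) : Prop :=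
  ∀ y : ℕ → ℕ, (∀ i < s, y i = x i) → (m, y) ∉ B

open Classical in
/-- The candidate witness held at stage `s` when the witnesses are searched in increasing order,
moving on whenever the current candidate gets refuted. -/
noncomputable def candidate (B : Set (ℕ × (ℕ → ℕ))) (x : ℕ → ℕ) : ℕ → ℕ
  | 0 => 0
  | s + 1 => if RefutedAt B (candidate B x s) s x then candidate B x s + 1 else candidate B x s

variable {B : Set (ℕ × (ℕ → ℕ))}

theorem eventually_agree (x : ℕ → ℕ) (s : ℕ) : ∀ᶠ y in 𝓝 x, ∀ i < s, y i = x i := by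
  have h : ∀ i ∈ Set.Iio s, ∀ᶠ y : ℕ → ℕ in 𝓝 x, y i = x i := fun i _ =>
    (continuous_apply (A := fun _ : ℕ => ℕ) i).continuousAt.eventually_mem
      (mem_nhds_discrete.2 rfl : {x i} ∈ 𝓝 (x i))
  exact (eventually_all_finite (Set.finite_Iio s)).2 h

theorem RefutedAt.mono {m s t : ℕ} {x : ℕ → ℕ} (h : RefutedAt B m s x) (hst : s ≤ t) :
    RefutedAt B m t x :=
  fun y hy => h y fun i hi => hy i (hi.trans_le hst)

theorem RefutedAt.congr {m s : ℕ} {x y : ℕ → ℕ} (hxy : ∀ i < s, x i = y i) :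
    RefutedAt B m s x ↔ RefutedAt B m s y := by
  constructor
  · exact fun h z hz => h z fun i hi => (hz i hi).trans (hxy i hi).symm
  · exact fun h z hz => h z fun i hi => (hz i hi).trans (hxy i hi)

theorem exists_refutedAt_iff (hB : IsClosed B) {m : ℕ} {x : ℕ → ℕ} :
    (∃ s, RefutedAt B m s x) ↔ (m, x) ∉ B := by
  refine ⟨fun ⟨s, hs⟩ => hs x fun _ _ => rfl, fun hx => ?_⟩
  have hU : {y : ℕ → ℕ | (m, y) ∉ B} ∈ 𝓝 x :=
    (hB.isOpen_compl.preimage (Continuous.prodMk_right m)).mem_nhds hx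
  rw [nhds_pi, Filter.mem_pi] at hU
  obtain ⟨I, hI, t, ht, hsub⟩ := hU
  obtain ⟨b, hb⟩ := hI.bddAbove
  refine ⟨b + 1, fun y hy => hsub fun i hi => ?_⟩
  rw [hy i (Nat.lt_succ_of_le (hb hi))]
  exact mem_of_mem_nhds (ht i)

open Classical in
theorem candidate_congr {x y : ℕ → ℕ} {s : ℕ} (hxy : ∀ i < s, x i = y i) :
    candidate B x s = candidate B y s := by
  induction s with
  | zero => rfl
  | succ s ih =>
    have h : ∀ i < s, x i = y i := fun i hi => hxy i (by lia)
    have e := ih h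
    exact if_congr (by rw [e]; exact RefutedAt.congr h) (by rw [e]) e

theorem continuous_candidate (s : ℕ) : Continuous fun x => candidate B x s := by
  refine continuous_iff_continuousAt.2 fun x => ?_
  refine (continuousAt_const (y := candidate B x s)).congr ?_
  filter_upwards [eventually_agree x s] with y hy
  exact (candidate_congr hy).symm

theorem candidate_succ_sub_eq_zero {x : ℕ → ℕ} {s : ℕ} :
    candidate B x (s + 1) - candidate B x s = 0 ↔ ¬ RefutedAt B (candidate B x s) s x := by
  simp only [candidate]
  split_ifs with h <;> simp [h]

theorem candidate_eq_of_not_refutedAt {x : ℕ → ℕ} {t k : ℕ} (ht : candidate B x t = k)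
    (h : ∀ s ≥ t, candidate B x s = k → ¬ RefutedAt B k s x) :
    ∀ s ≥ t, candidate B x s = k := by
  intro s hs
  induction s, hs using Nat.le_induction with
  | base => exact ht
  | succ s hs ih => simp [candidate, ih, h s hs ih]

theorem mem_candidate_of_forall_not_refutedAt (hB : IsClosed B) {x : ℕ → ℕ} {t : ℕ}
    (h : ∀ s ≥ t, ¬ RefutedAt B (candidate B x s) s x) : (candidate B x t, x) ∈ B := by
  have hc := candidate_eq_of_not_refutedAt (B := B) (x := x) (t := t) rfl
    fun s hs e => e ▸ h s hs
  by_contra hx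
  obtain ⟨s, hs⟩ := (exists_refutedAt_iff hB).2 hx
  refine h (max t s) (le_max_left _ _) ?_
  rw [hc _ (le_max_left _ _)]
  exact hs.mono (le_max_right _ _)

theorem exists_candidate_eq (hB : IsClosed B) {x : ℕ → ℕ} {n : ℕ}
    (hn : ∀ k < n, (k, x) ∉ B) : ∃ t, candidate B x t = n := by
  induction n with
  | zero => exact ⟨0, rfl⟩
  | succ n ih =>
    obtain ⟨t, ht⟩ := ih fun k hk => hn k (by lia)
    by_contra! hne
    have h : ∀ s ≥ t, candidate B x s = n → ¬ RefutedAt B n s x := fun s _ e hr =>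
      hne (s + 1) (by simp [candidate, e, hr])
    have hc := candidate_eq_of_not_refutedAt ht h
    refine hn n n.lt_succ_self (ht ▸ mem_candidate_of_forall_not_refutedAt hB fun s hs => ?_)
    rw [hc s hs]
    exact h s hs (hc s hs)

/-- The first stage at which `n` becomes the candidate. -/
noncomputable def arrivalTime (B : Set (ℕ × (ℕ → ℕ))) (p : ℕ × (ℕ → ℕ)) : ℕ :=
  sInf {t | candidate B p.2 t = p.1}

theorem continuousAt_arrivalTime {n : ℕ} {x : ℕ → ℕ} (h : ∃ t, candidate B x t = n) :
    ContinuousAt (arrivalTime B) (n, x) := by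
  have hmem : candidate B x (arrivalTime B (n, x)) = n := Nat.sInf_mem h
  refine (continuousAt_const (y := arrivalTime B (n, x))).congr ?_
  have h₁ : ∀ᶠ p : ℕ × (ℕ → ℕ) in 𝓝 (n, x), p.1 = n :=
    (continuousAt_fst (p := (n, x))).eventually_mem (mem_nhds_discrete.2 rfl : {n} ∈ 𝓝 n)
  have h₂ : ∀ᶠ p : ℕ × (ℕ → ℕ) in 𝓝 (n, x), ∀ i < arrivalTime B (n, x), p.2 i = x i :=
    (continuousAt_snd (p := (n, x))).eventually (eventually_agree x _)
  filter_upwards [h₁, h₂] with ⟨m, y⟩ hm hy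
  obtain rfl : m = n := hm
  have hy' : candidate B y (arrivalTime B (m, x)) = m := (candidate_congr hy).trans hmem
  refine le_antisymm ?_ (Nat.sInf_le hy')
  have hle : arrivalTime B (m, y) ≤ arrivalTime B (m, x) := Nat.sInf_le hy'
  have hmem' : candidate B y (arrivalTime B (m, y)) = m :=
    Nat.sInf_mem (s := {t | candidate B y t = m}) ⟨_, hy'⟩
  exact Nat.sInf_le ((candidate_congr fun i hi => hy i (hi.trans_le hle)).symm.trans hmem')

end UniqueWitness

/-- `Fin` is many-one (Levin) complete among Σ⁰₂ witnessed subsets of Baire space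
having the unique witness property. -/
theorem fin_complete_unique_witness (B : Set (ℕ × (ℕ → ℕ))) (hB : IsClosed B)
    (hdisj : ∀ n m : ℕ, n ≠ m → ∀ x : ℕ → ℕ, ¬ ((n, x) ∈ B ∧ (m, x) ∈ B)) :
    ManyOneRed (fun (n : ℕ) (x : ℕ → ℕ) => (n, x) ∈ B) FinW := by
  have lt_notMem : ∀ {n x}, (n, x) ∈ B → ∀ k < n, (k, x) ∉ B := fun hn k hk hkx =>
    hdisj _ _ hk.ne _ ⟨hkx, hn⟩
  have of_fin : ∀ {v : ℕ} {x : ℕ → ℕ},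
      FinW v (fun s => candidate B x (s + 1) - candidate B x s) → (candidate B x v, x) ∈ B :=
    fun h => mem_candidate_of_forall_not_refutedAt hB fun s hs =>
      candidate_succ_sub_eq_zero.1 (h s hs)
  have to_fin : ∀ {n : ℕ} {x : ℕ → ℕ}, (n, x) ∈ B →
      FinW (arrivalTime B (n, x)) (fun s => candidate B x (s + 1) - candidate B x s) := by
    intro n x hn s hs
    have hnot : ∀ s, ¬ RefutedAt B n s x := fun s h => h x (fun _ _ => rfl) hn
    have hmem : candidate B x (arrivalTime B (n, x)) = n :=
      Nat.sInf_mem (exists_candidate_eq hB (lt_notMem hn))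
    rw [candidate_succ_sub_eq_zero,
      candidate_eq_of_not_refutedAt hmem (fun s _ _ => hnot s) s hs]
    exact hnot s
  refine ⟨fun x s => candidate B x (s + 1) - candidate B x s, arrivalTime B,
    fun p => candidate B p.2 p.1, ?_, ?_, ?_, ?_, fun _ _ => to_fin, fun _ _ _ => of_fin⟩
  · refine continuous_pi fun s => ?_
    exact (continuous_candidate (s + 1)).sub (continuous_candidate s)
  · rintro ⟨n, x⟩ hn
    exact (continuousAt_arrivalTime
      (exists_candidate_eq hB (lt_notMem hn))).continuousWithinAt
  · exact (continuous_prod_of_discrete_left.2 continuous_candidate).continuousOn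
  · exact fun x => ⟨fun ⟨_, hn⟩ => ⟨_, to_fin hn⟩, fun ⟨_, hv⟩ => ⟨_, of_fin hv⟩⟩
end

section
/- For every continuous function f : ℕ × (ℕ → ℕ) → Bool (ℕ and Bool discrete, product topology), the witnessed set A on Baire space with witness type ℕ defined by A n x ↔ ∀ m ≥ n, f (m,x) = true satisfies A ≤ₘ Fin. (That is, Fin is many-one/Levin complete among Σ⁰₂ sets defined by formulas of the form ∃n ∀m≥n φ(m,x) with decidable matrix φ.) -/
/-- `Fin` is many-one (Levin) complete among Σ⁰₂ sets defined by formulas of the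
form ∃n ∀m≥n φ(m,x) with decidable matrix φ. -/
theorem fin_complete_eventually_form (f : ℕ × (ℕ → ℕ) → Bool) (hf : Continuous f) :
    ManyOneRed (fun (n : ℕ) (x : ℕ → ℕ) => ∀ m ≥ n, f (m, x) = true) FinW := by
  have key : ∀ (n : ℕ) (x : ℕ → ℕ),
      FinW n (fun m => bif f (m, x) then 0 else 1) ↔ ∀ m ≥ n, f (m, x) = true := by
    intro n x
    refine forall₂_congr fun m _ => ?_
    cases h : f (m, x) <;> simp [h]
  refine ⟨fun x m => bif f (m, x) then 0 else 1, Prod.fst, Prod.fst, ?_,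
    continuous_fst.continuousOn, continuous_fst.continuousOn,
    fun x => exists_congr fun n => (key n x).symm,
    fun n x h => (key n x).2 h, fun n x _ h => (key n x).1 h⟩
  refine continuous_pi fun m => ?_
  exact (continuous_of_discreteTopology (f := fun b : Bool => bif b then 0 else 1)).comp
    (hf.comp (Continuous.prodMk_right m))
end

section
/- BddSeq is many-one (Levin) complete among Σ⁰₂ witnessed subsets of Baire space having the increasing witness property: for every closed set B ⊆ ℕ × (ℕ → ℕ) with monotone sections (i.e., if n ≤ m and (n,x) ∈ B then (m,x) ∈ B), the associated witnessed set A_B satisfies A_B ≤ₘ BddSeq. -/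
/-- The witnessed set `BddSeq` of bounded sequences, with witness type ℕ. -/
def BddSeqW (b : ℕ) (x : ℕ → ℕ) : Prop := ∀ n, x n ≤ b

open Classical in
/-- The sequence whose entry at the pair `(n, s)` is `n + 1` if the first `s` values of `x` already
rule out `(n, x) ∈ B`, and `0` otherwise. -/
noncomputable def refutationSeq (B : Set (ℕ × (ℕ → ℕ))) (x : ℕ → ℕ) (k : ℕ) : ℕ :=
  if Disjoint {y | (k.unpair.1, y) ∈ B} (PiNat.cylinder x k.unpair.2) then k.unpair.1 + 1 else 0

theorem continuous_refutationSeq (B : Set (ℕ × (ℕ → ℕ))) : Continuous (refutationSeq B) := by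
  refine continuous_pi fun k => IsLocallyConstant.continuous ?_
  refine (IsLocallyConstant.iff_exists_open _).2 fun x =>
    ⟨PiNat.cylinder x k.unpair.2, PiNat.isOpen_cylinder _ x _, PiNat.self_mem_cylinder x _, ?_⟩
  intro y hy
  unfold refutationSeq
  rw [PiNat.mem_cylinder_iff_eq.1 hy]

theorem bddSeqW_refutationSeq_iff {B : Set (ℕ × (ℕ → ℕ))} (hB : IsClosed B)
    (hmono : ∀ n m : ℕ, n ≤ m → ∀ x : ℕ → ℕ, (n, x) ∈ B → (m, x) ∈ B) (b : ℕ) (x : ℕ → ℕ) :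
    BddSeqW b (refutationSeq B x) ↔ (b, x) ∈ B := by
  constructor
  · intro h
    by_contra hx
    have hclosed : IsClosed {y : ℕ → ℕ | (b, y) ∈ B} :=
      hB.preimage (Continuous.prodMk_right b)
    obtain ⟨s, hs⟩ := PiNat.exists_disjoint_cylinder hclosed hx
    have hle := h (Nat.pair b s)
    simp [refutationSeq, hs] at hle
  · intro h k
    unfold refutationSeq
    split_ifs with hk
    · by_contra! hlt
      exact Set.disjoint_left.1 hk (hmono b _ (Nat.lt_succ_iff.1 hlt) x h)
        (PiNat.self_mem_cylinder x _)
    · exact Nat.zero_le b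

/-- `BddSeq` is many-one (Levin) complete among Σ⁰₂ witnessed subsets of Baire
space having the increasing witness property. -/
theorem bddSeq_complete_increasing_witness (B : Set (ℕ × (ℕ → ℕ))) (hB : IsClosed B)
    (hmono : ∀ n m : ℕ, n ≤ m → ∀ x : ℕ → ℕ, (n, x) ∈ B → (m, x) ∈ B) :
    ManyOneRed (fun (n : ℕ) (x : ℕ → ℕ) => (n, x) ∈ B) BddSeqW := by
  have key := bddSeqW_refutationSeq_iff hB hmono
  exact ⟨refutationSeq B, Prod.fst, Prod.fst, continuous_refutationSeq B,
    continuous_fst.continuousOn, continuous_fst.continuousOn,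
    fun x => exists_congr fun b => (key b x).symm,
    fun b x => (key b x).2, fun b x _ => (key b x).1⟩
end

section
/- The unique witness property implies the increasing witness property: for every closed set B ⊆ ℕ × (ℕ → ℕ) whose sections are pairwise disjoint (n ≠ m implies no x has both (n,x) ∈ B and (m,x) ∈ B), there exists a closed set B' ⊆ ℕ × (ℕ → ℕ) with monotone sections (n ≤ m and (n,x) ∈ B' imply (m,x) ∈ B') such that: (i) for every x, (∃ n, (n,x) ∈ B) ↔ (∃ n, (n,x) ∈ B'); (ii) there is a map t : ℕ × (ℕ → ℕ) → ℕ, continuous on the subspace {(n,x) | (n,x) ∈ B}, with (t (n,x), x) ∈ B' whenever (n,x) ∈ B; (iii) there is a map s : ℕ × (ℕ → ℕ) → ℕ, continuous on the subspace {(n,x) | (n,x) ∈ B'}, with (s (n,x), x) ∈ B whenever (n,x) ∈ B'. -/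
/-- A selector choosing at each `(k, x)` of `S` some `n ≤ k` with `(n, x) ∈ B` is continuous on `S`
when `B` is closed with pairwise disjoint sections. -/
theorem continuousOn_of_bounded_unique_witness {X : Type*} [TopologicalSpace X]
    {B S : Set (ℕ × X)} (hB : IsClosed B)
    (hdisj : ∀ n m : ℕ, n ≠ m → ∀ x : X, ¬ ((n, x) ∈ B ∧ (m, x) ∈ B))
    {s : ℕ × X → ℕ} (hle : ∀ p ∈ S, s p ≤ p.1) (hs : ∀ p ∈ S, (s p, p.2) ∈ B) :
    ContinuousOn s S := by
  intro p hp
  have hfst : ∀ᶠ q : ℕ × X in nhds p, q.1 = p.1 :=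
    continuous_fst.continuousAt ((isOpen_discrete {p.1}).mem_nhds rfl)
  have havoid : ∀ᶠ q : ℕ × X in nhds p, ∀ m ∈ Set.Iic p.1, m ≠ s p → (m, q.2) ∉ B := by
    refine (Filter.eventually_all_finite (Set.finite_Iic p.1)).2 fun m _ => ?_
    by_cases hm : m = s p
    · simp [hm]
    · have hopen : IsOpen {q : ℕ × X | (m, q.2) ∉ B} :=
        hB.isOpen_compl.preimage (by fun_prop : Continuous fun q : ℕ × X => (m, q.2))
      filter_upwards [hopen.mem_nhds fun h => hdisj m (s p) hm p.2 ⟨h, hs p hp⟩] with q hq _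
      exact hq
  refine Filter.Tendsto.congr' (f₁ := fun _ => s p) ?_ tendsto_const_nhds
  filter_upwards [self_mem_nhdsWithin, hfst.filter_mono nhdsWithin_le_nhds,
    havoid.filter_mono nhdsWithin_le_nhds] with q hqS hq hqB
  by_contra hne
  exact hqB (s q) (hq ▸ hle q hqS) (Ne.symm hne) (hs q hqS)

/-- The pairs `(k, x)` with a witness `n ≤ k` for `x` in a closed set `B` form a closed set. -/
theorem isClosed_accumulated_sections {X : Type*} [TopologicalSpace X]
    {B : Set (ℕ × X)} (hB : IsClosed B) :
    IsClosed {p : ℕ × X | ∃ n ≤ p.1, (n, p.2) ∈ B} := by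
  rw [← isOpen_compl_iff, isOpen_iff_mem_nhds]
  intro p hp
  have hfst : ∀ᶠ q : ℕ × X in nhds p, q.1 = p.1 :=
    continuous_fst.continuousAt ((isOpen_discrete {p.1}).mem_nhds rfl)
  have havoid : ∀ᶠ q : ℕ × X in nhds p, ∀ m ∈ Set.Iic p.1, (m, q.2) ∉ B := by
    refine (Filter.eventually_all_finite (Set.finite_Iic p.1)).2 fun m hm => ?_
    have hopen : IsOpen {q : ℕ × X | (m, q.2) ∉ B} :=
      hB.isOpen_compl.preimage (by fun_prop : Continuous fun q : ℕ × X => (m, q.2))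
    exact hopen.mem_nhds fun h => hp ⟨m, hm, h⟩
  filter_upwards [hfst, havoid] with q hq hqB
  rintro ⟨n, hn, h⟩
  exact hqB n (hq ▸ hn) h

/-- The unique witness property implies the increasing witness property. -/
theorem unique_witness_implies_increasing_witness
    (B : Set (ℕ × (ℕ → ℕ))) (hB : IsClosed B)
    (hdisj : ∀ n m : ℕ, n ≠ m → ∀ x : ℕ → ℕ, ¬ ((n, x) ∈ B ∧ (m, x) ∈ B)) :
    ∃ B' : Set (ℕ × (ℕ → ℕ)), IsClosed B' ∧
      (∀ n m : ℕ, n ≤ m → ∀ x : ℕ → ℕ, (n, x) ∈ B' → (m, x) ∈ B') ∧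
      (∀ x : ℕ → ℕ, (∃ n, (n, x) ∈ B) ↔ (∃ n, (n, x) ∈ B')) ∧
      (∃ t : ℕ × (ℕ → ℕ) → ℕ,
        ContinuousOn t {p : ℕ × (ℕ → ℕ) | p ∈ B} ∧
        ∀ (n : ℕ) (x : ℕ → ℕ), (n, x) ∈ B → (t (n, x), x) ∈ B') ∧
      (∃ s : ℕ × (ℕ → ℕ) → ℕ,
        ContinuousOn s {p : ℕ × (ℕ → ℕ) | p ∈ B'} ∧
        ∀ (n : ℕ) (x : ℕ → ℕ), (n, x) ∈ B' → (s (n, x), x) ∈ B) := by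
  have hsel : ∀ p : ℕ × (ℕ → ℕ), ∃ m, (∃ n ≤ p.1, (n, p.2) ∈ B) → m ≤ p.1 ∧ (m, p.2) ∈ B := by
    intro p
    by_cases h : ∃ n ≤ p.1, (n, p.2) ∈ B
    · obtain ⟨n, hn⟩ := h
      exact ⟨n, fun _ => hn⟩
    · exact ⟨0, fun h' => absurd h' h⟩
  choose s hs using hsel
  refine ⟨{p | ∃ n ≤ p.1, (n, p.2) ∈ B}, isClosed_accumulated_sections hB, ?_, ?_, ?_, ?_⟩
  · rintro n m hnm x ⟨k, hk, h⟩
    exact ⟨k, hk.trans hnm, h⟩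
  · exact fun x => ⟨fun ⟨n, h⟩ => ⟨n, n, le_rfl, h⟩, fun ⟨_, n, _, h⟩ => ⟨n, h⟩⟩
  · exact ⟨Prod.fst, continuous_fst.continuousOn, fun n x h => ⟨n, le_rfl, h⟩⟩
  · exact ⟨s, continuousOn_of_bounded_unique_witness hB hdisj (fun p hp => (hs p hp).1)
      fun p hp => (hs p hp).2, fun n x h => (hs (n, x) h).2⟩
end

section
/- Fin is strictly below BddSeq in the many-one (Levin) degrees: Fin ≤ₘ BddSeq, but BddSeq is not many-one (Levin) reducible to Fin. -/
open Filter Topology in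
/-- Spikes of fixed height moving off to infinity converge to the zero sequence. -/
theorem tendsto_pi_single_atTop_nhds_zero (k : ℕ) :
    Tendsto (fun j : ℕ => (Pi.single j k : ℕ → ℕ)) atTop (𝓝 0) := by
  rw [tendsto_pi_nhds]
  intro i
  refine tendsto_const_nhds.congr' ?_
  filter_upwards [eventually_gt_atTop i] with j hj
  simp [hj.ne]

theorem manyOneRed_finW_bddSeqW : ManyOneRed FinW BddSeqW := by
  have bound_iff : ∀ n x, FinW n x ↔ BddSeqW n (fun m => if x m = 0 then 0 else m + 1) := by
    intro n x
    refine forall_congr' fun m => ?_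
    by_cases h : x m = 0 <;> simp [h]
  refine ⟨fun x m => if x m = 0 then 0 else m + 1, Prod.fst, Prod.fst, ?_,
    continuous_fst.continuousOn, continuous_fst.continuousOn,
    fun x => exists_congr fun n => bound_iff n x, fun w x => (bound_iff w x).1,
    fun v x _ => (bound_iff v x).2⟩
  refine continuous_pi fun m => ?_
  exact (continuous_of_discreteTopology (f := fun a : ℕ => if a = 0 then 0 else m + 1)).comp
    (continuous_apply m)

open Filter Topology in
theorem not_manyOneRed_bddSeqW_finW : ¬ ManyOneRed BddSeqW FinW := by
  rintro ⟨φ, rm, rp, hφ, hrm, hrp, -, hm, hp⟩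
  have bdd_zero : ∀ k, BddSeqW k 0 := fun k n => Nat.zero_le k
  have bdd_single : ∀ k j, BddSeqW k (Pi.single j k) := by
    intro k j n
    by_cases h : n = j <;> simp [h]
  set N := rm (0, 0)
  have fin_zero : FinW N (φ 0) := hm 0 0 (bdd_zero 0)
  set k := rp (N, 0) + 1
  set M := rm (k, 0)
  have spikes := tendsto_pi_single_atTop_nhds_zero k
  have witness_eq : ∀ᶠ j in atTop, rm (k, Pi.single j k) = M := by
    have lim : Tendsto (fun j : ℕ => (k, (Pi.single j k : ℕ → ℕ))) atTop
        (𝓝[{p : ℕ × (ℕ → ℕ) | BddSeqW p.1 p.2}] (k, 0)) :=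
      tendsto_nhdsWithin_iff.2 ⟨tendsto_const_nhds.prodMk_nhds spikes,
        Eventually.of_forall fun j => bdd_single k j⟩
    have := (hrm (k, 0) (bdd_zero k)).tendsto.comp lim
    rw [nhds_discrete, tendsto_pure] at this
    exact this
  have initial_eq : ∀ᶠ j in atTop, ∀ i < M, φ (Pi.single j k) i = φ 0 i := by
    refine (eventually_all_finite (Set.finite_lt_nat M)).2 fun i _ => ?_
    have := (((continuous_apply i).comp hφ).tendsto 0).comp spikes
    rw [nhds_discrete, tendsto_pure] at this
    exact this
  have fin_single : ∀ᶠ j in atTop, FinW N (φ (Pi.single j k)) := by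
    filter_upwards [witness_eq, initial_eq] with j hj hpre m hmN
    rcases lt_or_ge m M with h | h
    · rw [hpre m h, fin_zero m hmN]
    · exact hm k _ (bdd_single k j) m (hj ▸ h)
  have bound_eq : ∀ᶠ j in atTop, rp (N, Pi.single j k) = rp (N, 0) := by
    have lim : Tendsto (fun j : ℕ => (N, (Pi.single j k : ℕ → ℕ))) atTop
        (𝓝[{p : ℕ × (ℕ → ℕ) | (∃ w, BddSeqW w p.2) ∧ FinW p.1 (φ p.2)}] (N, 0)) :=
      tendsto_nhdsWithin_iff.2 ⟨tendsto_const_nhds.prodMk_nhds spikes,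
        fin_single.mono fun j hj => ⟨⟨k, bdd_single k j⟩, hj⟩⟩
    have := (hrp (N, 0) ⟨⟨0, bdd_zero 0⟩, fin_zero⟩).tendsto.comp lim
    rw [nhds_discrete, tendsto_pure] at this
    exact this
  obtain ⟨j, hj, hfin⟩ := (bound_eq.and fin_single).exists
  have := hp N _ ⟨k, bdd_single k j⟩ hfin j
  rw [hj, Pi.single_eq_same] at this
  omega

/-- `Fin` is strictly below `BddSeq` in the many-one (Levin) degrees. -/
theorem fin_lt_bddSeq : ManyOneRed FinW BddSeqW ∧ ¬ ManyOneRed BddSeqW FinW :=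
  ⟨manyOneRed_finW_bddSeqW, not_manyOneRed_bddSeqW_finW⟩
end

section
/- Every amalgamable Σ⁰₂ witnessed subset of Baire space is many-one (Levin) reducible to HalfTruth: for every closed set B ⊆ ℕ × (ℕ → ℕ) such that the associated witnessed set A_B is amalgamable, A_B ≤ₘ HalfTruth. -/
/-- The witnessed set `HalfTruth`, with witness type ℕ × ℕ. -/
def HalfTruthW (w : ℕ × ℕ) (x : ℕ → ℕ → ℕ) : Prop :=
  x w.1 = (fun _ => 0) ∨ x w.2 = (fun _ => 0)

/-- The `k`-th approximation to membership of `x` in a set `S` of Baire space: it is `0` when `S`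
contains a point that agrees with `x` on the first `k` coordinates, and `1` otherwise. -/
noncomputable def prefixTest (S : Set (ℕ → ℕ)) (x : ℕ → ℕ) (k : ℕ) : ℕ :=
  open Classical in if ∃ y ∈ S, ∀ i : Fin k, y i = x i then 0 else 1

theorem continuous_prefixTest (S : Set (ℕ → ℕ)) : Continuous (prefixTest S) := by
  classical
  refine continuous_pi fun k => ?_
  have hg : Continuous fun z : Fin k → ℕ => if ∃ y ∈ S, ∀ i : Fin k, y i = z i then 0 else 1 :=
    continuous_of_discreteTopology
  have hr : Continuous fun (x : ℕ → ℕ) (i : Fin k) => x i := by fun_prop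
  exact (hg.comp hr).congr fun x => by simp [prefixTest]

theorem prefixTest_eq_zero_iff {S : Set (ℕ → ℕ)} (hS : IsClosed S) (x : ℕ → ℕ) :
    prefixTest S x = (fun _ => 0) ↔ x ∈ S := by
  constructor
  · intro h
    have hex (k : ℕ) : ∃ y ∈ S, ∀ i : Fin k, y i = x i := by
      by_contra hk
      simpa [prefixTest, hk] using congrFun h k
    choose y hyS hy using hex
    refine hS.mem_of_tendsto (f := y) (b := Filter.atTop) ?_ (.of_forall hyS)
    refine tendsto_pi_nhds.2 fun i => tendsto_const_nhds.congr' ?_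
    filter_upwards [Filter.eventually_gt_atTop i] with k hk
    exact (hy k ⟨i, hk⟩).symm
  · intro h
    funext k
    exact if_pos ⟨x, h, fun _ => rfl⟩

/-- Every amalgamable Σ⁰₂ witnessed subset of Baire space is many-one (Levin)
reducible to `HalfTruth`. -/
theorem amalgamable_manyOneRed_halfTruth (B : Set (ℕ × (ℕ → ℕ))) (hB : IsClosed B)
    (hamalg : Amalgamable (fun (n : ℕ) (x : ℕ → ℕ) => (n, x) ∈ B)) :
    ManyOneRed (fun (n : ℕ) (x : ℕ → ℕ) => (n, x) ∈ B) HalfTruthW := by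
  obtain ⟨F, hF, hFA⟩ := hamalg
  have hzero (n : ℕ) (x : ℕ → ℕ) :
      prefixTest {y | (n, y) ∈ B} x = (fun _ => 0) ↔ (n, x) ∈ B :=
    prefixTest_eq_zero_iff (hB.preimage (Continuous.prodMk_right n)) x
  refine ⟨fun x n => prefixTest {y | (n, y) ∈ B} x, fun p => (p.1, p.1),
    fun p => F ([p.1.1, p.1.2], p.2), continuous_pi fun n => continuous_prefixTest _,
    by fun_prop, ?_, fun x => ?_, fun w x h => Or.inl ((hzero w x).2 h), fun v x hx hv => ?_⟩
  · have hl : Continuous fun v : ℕ × ℕ => [v.1, v.2] := continuous_of_discreteTopology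
    exact hF.comp ((hl.comp continuous_fst).prodMk continuous_snd).continuousOn fun p hp => hp.1
  · simp only [HalfTruthW, hzero]
    exact ⟨fun ⟨n, h⟩ => ⟨(n, n), Or.inl h⟩, fun ⟨v, h⟩ => h.elim (⟨v.1, ·⟩) (⟨v.2, ·⟩)⟩
  · simp only [HalfTruthW, hzero] at hv
    exact hFA _ x hx (by simpa using hv)
end

section
/- Split Lemma: Let A be a witnessed set on Baire space (ℕ → ℕ) with countable discrete witness type W_A, and B a witnessed set on a topological space Y with countable discrete witness type W_B. Call x ∈ |A| splittable if for every ℓ ∈ ℕ and every j ∈ W_A there exists x' ∈ |A| with x' m = x m for all m < ℓ, such that ¬ A j x', and for every k ≠ j with A k x, also A k x'. If A ≤ₘ B via (φ, r₋, r₊), x ∈ |A| is splittable, and A k x, then r₊ (r₋ (k, x), x) = k. -/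
open Filter Topology in
/-- A sequence whose `n`-th term agrees with `x` below `n` converges to `x` in Baire space. -/
theorem tendsto_of_forall_lt_eq {x : ℕ → ℕ} {u : ℕ → ℕ → ℕ}
    (h : ∀ n, ∀ m < n, u n m = x m) : Tendsto u atTop (𝓝 x) := by
  refine tendsto_pi_nhds.2 fun m => tendsto_const_nhds.congr' ?_
  filter_upwards [eventually_gt_atTop m] with n hn
  exact (h n m hn).symm

open Filter Topology in
/-- A map to a discrete space that is continuous on a set `s` is eventually constant along
`(w, u n)` for every sequence `u` converging to `x` with `(w, u n)` eventually in `s`. -/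
theorem ContinuousOn.eventually_eq_prodMk {W X Z : Type*} [TopologicalSpace W]
    [TopologicalSpace X] [TopologicalSpace Z] [DiscreteTopology Z] {f : W × X → Z}
    {s : Set (W × X)} (hf : ContinuousOn f s) {w : W} {x : X} (hx : (w, x) ∈ s)
    {u : ℕ → X} (hu : Tendsto u atTop (𝓝 x)) (hus : ∀ᶠ n in atTop, (w, u n) ∈ s) :
    ∀ᶠ n in atTop, f (w, u n) = f (w, x) := by
  have h : Tendsto (fun n => f (w, u n)) atTop (𝓝 (f (w, x))) :=
    (hf (w, x) hx).tendsto.comp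
      (tendsto_nhdsWithin_iff.2 ⟨tendsto_const_nhds.prodMk_nhds hu, hus⟩)
  rw [nhds_discrete] at h
  exact tendsto_pure.1 h

/-- Split Lemma: if `A ≤ₘ B` via `(φ, r₋, r₊)`, `x ∈ |A|` is splittable and
`A k x`, then `r₊ (r₋ (k, x), x) = k`. -/
theorem split_lemma {Y WA WB : Type*} [TopologicalSpace Y]
    [TopologicalSpace WA] [DiscreteTopology WA] [Countable WA]
    [TopologicalSpace WB] [DiscreteTopology WB] [Countable WB]
    (A : WA → (ℕ → ℕ) → Prop) (B : WB → Y → Prop)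
    (φ : (ℕ → ℕ) → Y) (rm : WA × (ℕ → ℕ) → WB) (rp : WB × (ℕ → ℕ) → WA)
    (hφ : Continuous φ)
    (hrm : ContinuousOn rm {p : WA × (ℕ → ℕ) | A p.1 p.2})
    (hrp : ContinuousOn rp
      {p : WB × (ℕ → ℕ) | (∃ w, A w p.2) ∧ B p.1 (φ p.2)})
    (hiff : ∀ x, (∃ w, A w x) ↔ (∃ v, B v (φ x)))
    (hminus : ∀ w x, A w x → B (rm (w, x)) (φ x))
    (hplus : ∀ v x, (∃ w, A w x) → B v (φ x) → A (rp (v, x)) x)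
    (x : ℕ → ℕ) (hx : ∃ w, A w x)
    (hsplit : ∀ (ℓ : ℕ) (j : WA), ∃ x' : ℕ → ℕ,
      (∃ w, A w x') ∧ (∀ m < ℓ, x' m = x m) ∧ ¬ A j x' ∧
      ∀ k, k ≠ j → A k x → A k x')
    (k : WA) (hk : A k x) :
    rp (rm (k, x), x) = k := by
  by_contra hne
  choose u hu_mem hu_eq hu_not hu_keep using
    fun ℓ => hsplit ℓ (rp (rm (k, x), x))
  have hu := tendsto_of_forall_lt_eq hu_eq
  have hk_u : ∀ n, A k (u n) := fun n => hu_keep n k (Ne.symm hne) hk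
  have hrm_u := hrm.eventually_eq_prodMk (w := k) hk hu (.of_forall hk_u)
  have hB : ∀ᶠ n in Filter.atTop, B (rm (k, x)) (φ (u n)) :=
    hrm_u.mono fun n hn => hn ▸ hminus k (u n) (hk_u n)
  have hrp_u := hrp.eventually_eq_prodMk (w := rm (k, x)) ⟨hx, hminus k x hk⟩ hu
    (hB.mono fun n hn => ⟨hu_mem n, hn⟩)
  obtain ⟨n, hBn, hn⟩ := (hB.and hrp_u).exists
  exact hu_not n (hn ▸ hplus _ (u n) (hu_mem n) hBn)
end

section
/- HalfTruth is many-one (Levin) reducible to DisConn: HalfTruth ≤ₘ DisConn. (DisConn is half Σ⁰₂-hard.) -/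
/-- Connectivity relation of a graph code `g = (v, e)`. -/
def ConnG (g : (ℕ → Bool) × (ℕ → ℕ → Bool)) : ℕ → ℕ → Prop :=
  Relation.ReflTransGen
    (fun a b => g.1 a = true ∧ g.1 b = true ∧ (g.2 a b = true ∨ g.2 b a = true))

/-- The witnessed set `DisConn` of disconnected graph codes, with witness type ℕ × ℕ. -/
def DisConnW (w : ℕ × ℕ) (g : (ℕ → Bool) × (ℕ → ℕ → Bool)) : Prop :=
  g.1 w.1 = true ∧ g.1 w.2 = true ∧ ¬ ConnG g w.1 w.2

/-- The graph on pairs `(n, k)` (coded by `Nat.pair`) in which every `(n, k)` is joined to `(n, 0)`,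
and `(n, k)` is joined to the base point `(0, 0)` whenever `x (n - 1) k ≠ 0`. -/
def columnGraph (x : ℕ → ℕ → ℕ) : (ℕ → Bool) × (ℕ → ℕ → Bool) :=
  (fun _ => true, fun a b => decide (b = Nat.pair a.unpair.1 0 ∨
    (b = 0 ∧ x (a.unpair.1 - 1) a.unpair.2 ≠ 0)))

theorem continuous_columnGraph : Continuous columnGraph := by
  refine Continuous.prodMk continuous_const
    (continuous_pi fun a => continuous_pi fun b => ?_)
  exact (continuous_of_discreteTopology (f := fun m : ℕ =>
    decide (b = Nat.pair a.unpair.1 0 ∨ (b = 0 ∧ m ≠ 0)))).comp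
      ((continuous_apply a.unpair.2).comp (continuous_apply (a.unpair.1 - 1)))

theorem ConnG.symm {g : (ℕ → Bool) × (ℕ → ℕ → Bool)} {a b : ℕ} (h : ConnG g a b) :
    ConnG g b a :=
  have : Std.Symm fun a b => g.1 a = true ∧ g.1 b = true ∧ (g.2 a b = true ∨ g.2 b a = true) :=
    ⟨fun _ _ h => ⟨h.2.1, h.1, h.2.2.symm⟩⟩
  Relation.ReflTransGen.stdSymm.symm _ _ h

theorem connG_columnGraph_zero {x : ℕ → ℕ → ℕ} {a : ℕ}
    (h : x (a.unpair.1 - 1) ≠ fun _ => 0) : ConnG (columnGraph x) a 0 := by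
  obtain ⟨k, hk⟩ := Function.ne_iff.mp h
  have column (c : ℕ) : ConnG (columnGraph x) c (Nat.pair c.unpair.1 0) :=
    .single ⟨rfl, rfl, .inl (by simp [columnGraph])⟩
  have back := (column (Nat.pair a.unpair.1 k)).symm
  rw [Nat.unpair_pair] at back
  refine ((column a).trans back).trans (.single ⟨rfl, rfl, .inl ?_⟩)
  simpa [columnGraph] using Or.inr hk

open Classical in
/-- The component of the vertices `(n, k)` of `columnGraph x`, given as its least first entry. -/
noncomputable def columnComponent (x : ℕ → ℕ → ℕ) (n : ℕ) : ℕ :=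
  if x (n - 1) = fun _ => 0 then n else 0

theorem columnComponent_eq_of_edge {x : ℕ → ℕ → ℕ} {a b : ℕ}
    (h : (columnGraph x).2 a b = true) :
    columnComponent x a.unpair.1 = columnComponent x b.unpair.1 := by
  rcases of_decide_eq_true h with rfl | ⟨rfl, hk⟩
  · rw [Nat.unpair_pair]
  · have hx : x (a.unpair.1 - 1) ≠ fun _ => 0 := fun h0 => hk (congrFun h0 _)
    simp [columnComponent, hx]

theorem columnComponent_eq_of_connG {x : ℕ → ℕ → ℕ} {a b : ℕ}
    (h : ConnG (columnGraph x) a b) :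
    columnComponent x a.unpair.1 = columnComponent x b.unpair.1 := by
  induction h with
  | refl => rfl
  | tail _ hbc ih =>
    exact ih.trans (hbc.2.2.elim columnComponent_eq_of_edge
      fun h => (columnComponent_eq_of_edge h).symm)

theorem HalfTruthW.disConnW_columnGraph {w : ℕ × ℕ} {x : ℕ → ℕ → ℕ} (h : HalfTruthW w x) :
    DisConnW (Nat.pair (w.1 + 1) 0, if w.1 = w.2 then 0 else Nat.pair (w.2 + 1) 0)
      (columnGraph x) := by
  refine ⟨rfl, rfl, fun hc => ?_⟩
  have hcomp := columnComponent_eq_of_connG hc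
  unfold HalfTruthW at h
  by_cases hw : w.1 = w.2
  · simp_all [columnComponent]
  · rw [if_neg hw, Nat.unpair_pair, Nat.unpair_pair] at hcomp
    simp only [columnComponent, Nat.add_sub_cancel] at hcomp
    split_ifs at hcomp <;> first | omega | tauto

theorem DisConnW.halfTruthW {v : ℕ × ℕ} {x : ℕ → ℕ → ℕ} (h : DisConnW v (columnGraph x)) :
    HalfTruthW (v.1.unpair.1 - 1, v.2.unpair.1 - 1) x := by
  by_contra hn
  obtain ⟨h1, h2⟩ := not_or.mp hn
  exact h.2.2 ((connG_columnGraph_zero h1).trans (connG_columnGraph_zero h2).symm)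

/-- `HalfTruth` is many-one (Levin) reducible to `DisConn`
(`DisConn` is half Σ⁰₂-hard). -/
theorem halfTruth_manyOneRed_disConn : ManyOneRed HalfTruthW DisConnW := by
  refine ⟨columnGraph,
    fun p => (Nat.pair (p.1.1 + 1) 0, if p.1.1 = p.1.2 then 0 else Nat.pair (p.1.2 + 1) 0),
    fun p => (p.1.1.unpair.1 - 1, p.1.2.unpair.1 - 1), continuous_columnGraph, ?_, ?_,
    fun x => ⟨fun ⟨_, h⟩ => ⟨_, h.disConnW_columnGraph⟩, fun ⟨_, h⟩ => ⟨_, h.halfTruthW⟩⟩,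
    fun _ _ h => h.disConnW_columnGraph, fun _ _ _ h => h.halfTruthW⟩
  · exact ((continuous_of_discreteTopology (f := fun w : ℕ × ℕ =>
      (Nat.pair (w.1 + 1) 0, if w.1 = w.2 then 0 else Nat.pair (w.2 + 1) 0))).comp
        continuous_fst).continuousOn
  · exact ((continuous_of_discreteTopology (f := fun v : ℕ × ℕ =>
      (v.1.unpair.1 - 1, v.2.unpair.1 - 1))).comp continuous_fst).continuousOn
end

section
/- DisConn is not many-one (Levin) reducible to HalfTruth: DisConn ≰ₘ HalfTruth. -/
open Filter Topology

/-- A function into a discrete space that is continuous on `{(w, x) | R w x}` is constant in `x`,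
near any of its points, for a fixed `w`. -/
theorem eventually_eq_of_continuousOn_witness {X WA WB : Type*} [TopologicalSpace X]
    [TopologicalSpace WA] [TopologicalSpace WB] [DiscreteTopology WB] {R : WA → X → Prop}
    {r : WA × X → WB} (hr : ContinuousOn r {p : WA × X | R p.1 p.2}) {w : WA} {x₀ : X}
    (h₀ : R w x₀) : ∀ᶠ x in 𝓝 x₀, R w x → r (w, x) = r (w, x₀) := by
  have h : ∀ᶠ p in 𝓝[{p : WA × X | R p.1 p.2}] (w, x₀), r p = r (w, x₀) :=
    (hr (w, x₀) h₀).eventually (isOpen_discrete {r (w, x₀)} |>.mem_nhds rfl)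
  rw [eventually_nhdsWithin_iff] at h
  have hc : Tendsto (fun x : X => (w, x)) (𝓝 x₀) (𝓝 (w, x₀)) :=
    (Continuous.prodMk_right w).tendsto x₀
  exact hc.eventually h

/-- The edgeless graph on the vertices `0, 1, 2, 3`. -/
def edgelessFour : (ℕ → Bool) × (ℕ → ℕ → Bool) :=
  (fun x => decide (x < 4), fun _ _ => false)

/-- The graph on `0, 1, 2, 3` and all numbers from `N` on, in which every number from `N` on is
joined to the vertices of its own colour; the colour of a vertex depends on its residue mod 4. -/
def cutGraph (f : ℕ → Bool) (N : ℕ) : (ℕ → Bool) × (ℕ → ℕ → Bool) :=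
  (fun x => decide (x < 4 ∨ N ≤ x), fun x y => decide (N ≤ y ∧ f (x % 4) = f (y % 4)))

theorem connG_edgelessFour_iff {a b : ℕ} : ConnG edgelessFour a b ↔ a = b := by
  constructor
  · intro h
    induction h with
    | refl => rfl
    | tail _ h _ => simp [edgelessFour] at h
  · rintro rfl
    exact Relation.ReflTransGen.refl

theorem disConnW_edgelessFour_iff {a b : ℕ} :
    DisConnW (a, b) edgelessFour ↔ a < 4 ∧ b < 4 ∧ a ≠ b := by
  simp only [DisConnW, connG_edgelessFour_iff]
  simp [edgelessFour]

theorem connG_cutGraph_iff {f : ℕ → Bool} {N a b : ℕ} (ha : a < 4) (hb : b < 4) :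
    ConnG (cutGraph f N) a b ↔ f a = f b := by
  constructor
  · intro h
    have key : ∀ c, ConnG (cutGraph f N) a c → f (a % 4) = f (c % 4) := by
      intro c hc
      induction hc with
      | refl => rfl
      | tail _ h ih =>
        simp only [cutGraph, decide_eq_true_eq] at h
        rcases h.2.2 with h' | h'
        · exact ih.trans h'.2
        · exact ih.trans h'.2.symm
    simpa [Nat.mod_eq_of_lt ha, Nat.mod_eq_of_lt hb] using key b h
  · intro h
    have hm : (4 * N + a) % 4 = a := by omega
    have hN : N ≤ 4 * N + a := by omega
    refine (Relation.ReflTransGen.single (b := 4 * N + a) ?_).tail ?_ <;>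
      simp [cutGraph, Nat.mod_eq_of_lt ha, Nat.mod_eq_of_lt hb, ha, hb, h, hm, hN]

theorem disConnW_cutGraph {f : ℕ → Bool} {N a b : ℕ} (ha : a < 4) (hb : b < 4)
    (h : f a ≠ f b) : DisConnW (a, b) (cutGraph f N) :=
  ⟨by simp [cutGraph, ha], by simp [cutGraph, hb], by rwa [connG_cutGraph_iff ha hb]⟩

theorem tendsto_cutGraph (f : ℕ → Bool) :
    Tendsto (cutGraph f) atTop (𝓝 edgelessFour) := by
  refine Tendsto.prodMk_nhds (tendsto_pi_nhds.2 fun x => ?_)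
    (tendsto_pi_nhds.2 fun x => tendsto_pi_nhds.2 fun y => ?_)
  · refine tendsto_const_nhds.congr' ?_
    filter_upwards [eventually_gt_atTop x] with N hN
    simp [not_le.2 hN]
  · refine tendsto_const_nhds.congr' ?_
    filter_upwards [eventually_gt_atTop y] with N hN
    simp [not_le.2 hN]

/-- If all cuts in `Q` separate one common pair of vertices, then `Q` contains at most two of the
four cuts that split off a single vertex, and not the cut `02|13` together with the cuts splitting
off both ends of one of its sides. -/
theorem cuts_of_common_pair {Q : (ℕ → Bool) → Prop}
    (h : ∃ u v, u < 4 ∧ v < 4 ∧ u ≠ v ∧ ∀ f, Q f → f u ≠ f v) :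
    ¬ (Q (· == 0) ∧ Q (· == 1) ∧ Q (· == 2)) ∧ ¬ (Q (· == 0) ∧ Q (· == 1) ∧ Q (· == 3)) ∧
    ¬ (Q (· == 0) ∧ Q (· == 2) ∧ Q (· == 3)) ∧ ¬ (Q (· == 1) ∧ Q (· == 2) ∧ Q (· == 3)) ∧
    ¬ (Q (· == 0) ∧ Q (· == 2) ∧ Q (· % 2 == 0)) ∧
    ¬ (Q (· == 1) ∧ Q (· == 3) ∧ Q (· % 2 == 0)) := by
  obtain ⟨u, v, hu, hv, huv, h⟩ := h
  have h0 := h (· == 0)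
  have h1 := h (· == 1)
  have h2 := h (· == 2)
  have h3 := h (· == 3)
  have h4 := h (· % 2 == 0)
  interval_cases u <;> interval_cases v <;> simp_all

/-- `DisConn` is not many-one (Levin) reducible to `HalfTruth`. -/
theorem disConn_not_manyOneRed_halfTruth : ¬ ManyOneRed DisConnW HalfTruthW := by
  rintro ⟨φ, rm, rp, hφ, hrm, hrp, hiff, hm, hp⟩
  have cover : ∀ u v, u < 4 → v < 4 → u ≠ v → ∃ a b, ∀ᶠ g in 𝓝 edgelessFour,
      DisConnW (u, v) g → φ g a = (fun _ => 0) ∨ φ g b = (fun _ => 0) := by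
    intro u v hu hv huv
    have h₀ : DisConnW (u, v) edgelessFour := disConnW_edgelessFour_iff.2 ⟨hu, hv, huv⟩
    refine ⟨(rm ((u, v), edgelessFour)).1, (rm ((u, v), edgelessFour)).2, ?_⟩
    filter_upwards [eventually_eq_of_continuousOn_witness hrm h₀] with g hg hd
    have := hm _ _ hd
    rwa [hg hd] at this
  have separate : ∀ i j, ∃ u v, u < 4 ∧ v < 4 ∧ u ≠ v ∧ ∀ᶠ g in 𝓝 edgelessFour,
      HalfTruthW (i, j) (φ g) → ¬ ConnG g u v := by
    intro i j
    by_cases h₀ : HalfTruthW (i, j) (φ edgelessFour)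
    · have hR : (∃ w, DisConnW w edgelessFour) ∧ HalfTruthW (i, j) (φ edgelessFour) :=
        ⟨(hiff _).2 ⟨_, h₀⟩, h₀⟩
      obtain ⟨hu, hv, huv⟩ := disConnW_edgelessFour_iff.1 (hp _ _ hR.1 h₀)
      refine ⟨_, _, hu, hv, huv, ?_⟩
      filter_upwards [eventually_eq_of_continuousOn_witness
        (R := fun w g => (∃ w, DisConnW w g) ∧ HalfTruthW w (φ g)) hrp hR] with g hg hj
      have hd : ∃ w, DisConnW w g := (hiff g).2 ⟨_, hj⟩
      have := hp _ _ hd hj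
      rw [hg ⟨hd, hj⟩] at this
      exact this.2.2
    · refine ⟨0, 1, by norm_num, by norm_num, by norm_num, ?_⟩
      have hopen : IsOpen {g | ¬ HalfTruthW (i, j) (φ g)} := by
        have hclosed : IsClosed {g | HalfTruthW (i, j) (φ g)} :=
          (isClosed_eq (by fun_prop) continuous_const).union
            (isClosed_eq (by fun_prop) continuous_const)
        exact hclosed.isOpen_compl
      filter_upwards [hopen.mem_nhds h₀] with g hg hj
      exact absurd hj hg
  obtain ⟨a, b, hab⟩ := cover 0 1 (by norm_num) (by norm_num) (by norm_num)
  obtain ⟨c, d, hcd⟩ := cover 2 3 (by norm_num) (by norm_num) (by norm_num)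
  let P : ℕ → ℕ → (ℕ → Bool) → Prop := fun N i f => φ (cutGraph f N) i = fun _ => 0
  have evAB : ∀ f : ℕ → Bool, f 0 ≠ f 1 → ∀ᶠ N in atTop, P N a f ∨ P N b f := fun f hf =>
    ((tendsto_cutGraph f).eventually hab).mono fun N h =>
      h (disConnW_cutGraph (by norm_num) (by norm_num) hf)
  have evCD : ∀ f : ℕ → Bool, f 2 ≠ f 3 → ∀ᶠ N in atTop, P N c f ∨ P N d f := fun f hf =>
    ((tendsto_cutGraph f).eventually hcd).mono fun N h =>
      h (disConnW_cutGraph (by norm_num) (by norm_num) hf)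
  let cuts : Set (ℕ → Bool) := {(· == 0), (· == 1), (· == 2), (· == 3), (· % 2 == 0)}
  have evSep : ∀ i j, ∀ᶠ N in atTop, ∃ u v, u < 4 ∧ v < 4 ∧ u ≠ v ∧
      ∀ f, (f ∈ cuts ∧ (P N i f ∨ P N j f)) → f u ≠ f v := by
    intro i j
    obtain ⟨u, v, hu, hv, huv, h⟩ := separate i j
    have hfin : cuts.Finite := by simp [cuts]
    have := (eventually_all_finite hfin).2 fun f _ => (tendsto_cutGraph f).eventually h
    filter_upwards [this] with N hN
    refine ⟨u, v, hu, hv, huv, fun f hf => ?_⟩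
    have := hN f hf.1 hf.2
    rwa [connG_cutGraph_iff hu hv] at this
  obtain ⟨N, h0, h1, h4, h2, h3, hac, had, hbc, hbd⟩ :=
    ((evAB (· == 0) (by simp)).and <| (evAB (· == 1) (by simp)).and <|
      (evAB (· % 2 == 0) (by simp)).and <| (evCD (· == 2) (by simp)).and <|
      (evCD (· == 3) (by simp)).and <| (evSep a c).and <| (evSep a d).and <|
      (evSep b c).and (evSep b d)).exists
  have m0 : (· == 0) ∈ cuts := by simp [cuts]
  have m1 : (· == 1) ∈ cuts := by simp [cuts]
  have m2 : (· == 2) ∈ cuts := by simp [cuts]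
  have m3 : (· == 3) ∈ cuts := by simp [cuts]
  have m4 : (· % 2 == 0) ∈ cuts := by simp [cuts]
  have kac := cuts_of_common_pair hac
  have kad := cuts_of_common_pair had
  have kbc := cuts_of_common_pair hbc
  have kbd := cuts_of_common_pair hbd
  clear hac had hbc hbd
  simp only [m0, m1, m2, m3, m4, true_and] at kac kad kbc kbd
  clear_value P
  clear m0 m1 m2 m3 m4 evAB evCD evSep
  grind
end

section
/- Truth is many-one (Levin) complete with respect to Σ⁰₂ witnessed subsets of Baire space: for every closed set B ⊆ ℕ × (ℕ → ℕ), the associated witnessed set A_B satisfies A_B ≤ₘ Truth. -/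
/-- The Σ⁰₂-complete witnessed set `Truth`, with witness type ℕ. -/
def TruthW (n : ℕ) (x : ℕ → ℕ → ℕ) : Prop := x n = fun _ => 0

/-- Some point of the `n`-th section of `B` agrees with `x` on the first `k` coordinates. -/
def PrefixMeets (B : Set (ℕ × (ℕ → ℕ))) (x : ℕ → ℕ) (n k : ℕ) : Prop :=
  ∃ y : ℕ → ℕ, (∀ i < k, y i = x i) ∧ (n, y) ∈ B

theorem IsClosed.mem_iff_forall_prefixMeets {B : Set (ℕ × (ℕ → ℕ))} (hB : IsClosed B)
    (n : ℕ) (x : ℕ → ℕ) : (n, x) ∈ B ↔ ∀ k, PrefixMeets B x n k := by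
  refine ⟨fun h k => ⟨x, fun _ _ => rfl, h⟩, fun h => ?_⟩
  choose y hyx hyB using h
  have hlim : Filter.Tendsto y Filter.atTop (nhds x) := by
    refine tendsto_pi_nhds.2 fun i => tendsto_const_nhds.congr' ?_
    filter_upwards [Filter.eventually_gt_atTop i] with k hk
    exact (hyx k i hk).symm
  exact hB.mem_of_tendsto (tendsto_const_nhds.prodMk_nhds hlim) (Filter.Eventually.of_forall hyB)

open Classical in
/-- The `n`-th row vanishes exactly as long as the prefixes of `x` meet the `n`-th section
of `B`. -/
noncomputable def prefixRows (B : Set (ℕ × (ℕ → ℕ))) (x : ℕ → ℕ) (n k : ℕ) : ℕ :=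
  if PrefixMeets B x n k then 0 else 1

theorem continuous_prefixRows (B : Set (ℕ × (ℕ → ℕ))) : Continuous (prefixRows B) := by
  refine continuous_pi fun n => continuous_pi fun k => ?_
  refine (IsLocallyConstant.iff_eventually_eq _).2 (fun x => ?_) |>.continuous
  have hagree : ∀ᶠ z in nhds x, ∀ i ∈ Set.Iio k, z i = x i :=
    (Filter.eventually_all_finite (Set.finite_Iio k)).2 fun i _ =>
      (continuous_apply i).continuousAt.eventually (by simp : ∀ᶠ m in nhds (x i), m = x i)
  filter_upwards [hagree] with z hz
  have hiff : PrefixMeets B z n k ↔ PrefixMeets B x n k :=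
    exists_congr fun y => and_congr_left fun _ =>
      forall₂_congr fun i hi => by rw [hz i hi]
  by_cases h : PrefixMeets B x n k <;> simp [prefixRows, hiff, h]

theorem IsClosed.truthW_prefixRows_iff {B : Set (ℕ × (ℕ → ℕ))} (hB : IsClosed B)
    (n : ℕ) (x : ℕ → ℕ) : TruthW n (prefixRows B x) ↔ (n, x) ∈ B := by
  rw [hB.mem_iff_forall_prefixMeets, TruthW, funext_iff]
  simp [prefixRows]

/-- `Truth` is many-one (Levin) complete with respect to Σ⁰₂ witnessed subsets of
Baire space. -/
theorem truth_complete_sigma02 (B : Set (ℕ × (ℕ → ℕ))) (hB : IsClosed B) :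
    ManyOneRed (fun (n : ℕ) (x : ℕ → ℕ) => (n, x) ∈ B) TruthW := by
  refine ⟨prefixRows B, Prod.fst, Prod.fst, continuous_prefixRows B, continuous_fst.continuousOn,
    continuous_fst.continuousOn, fun x => ?_, fun n x h => ?_, fun n x _ h => ?_⟩
  · exact exists_congr fun n => (hB.truthW_prefixRows_iff n x).symm
  · exact (hB.truthW_prefixRows_iff n x).2 h
  · exact (hB.truthW_prefixRows_iff n x).1 h
end

section
/- Truth is many-one (Levin) reducible to NonDense, and moreover the reduction map φ can be chosen so that φ x codes a linear order for every x. Consequently NonDense is many-one (Levin) complete among Σ⁰₂ witnessed subsets. -/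
/-- The witnessed set `NonDense` of non-dense linear orders, with witness type ℕ × ℕ. -/
def NonDenseW (w : ℕ × ℕ) (x : ℕ → ℕ → Bool) : Prop :=
  x w.1 w.1 = true ∧ x w.2 w.2 = true ∧ x w.1 w.2 = true ∧ w.1 ≠ w.2 ∧
  ∀ c, x c c = true → (x c w.1 = true ∨ x w.2 c = true)

/-- A binary-relation code codes a linear order: reflexive, antisymmetric,
transitive, and total on its field. -/
def IsLinearOrderCode (x : ℕ → ℕ → Bool) : Prop :=
  (∀ a, x a a = true → x a a = true) ∧
  (∀ a b, x a a = true → x b b = true → x a b = true → x b a = true → a = b) ∧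
  (∀ a b c, x a a = true → x b b = true → x c c = true →
    x a b = true → x b c = true → x a c = true) ∧
  (∀ a b, x a a = true → x b b = true → (x a b = true ∨ x b a = true))

/-- A fixed enumeration of the rationals. -/
noncomputable def ratEnum : ℕ ≃ ℚ := (Denumerable.eqv ℚ).symm

/-- The suborder of `ℚ` (in codes) attached to `x`: it contains all integers, and a nonintegral
rational `q` enters it as soon as `x ⌊q⌋` is seen to be nonzero before the code of `q`. -/
def InSuborder (x : ℕ → ℕ → ℕ) (a : ℕ) : Prop :=
  (⌊ratEnum a⌋ : ℚ) = ratEnum a ∨ ∃ k ∈ Finset.range a, x ⌊ratEnum a⌋.toNat k ≠ 0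

open Classical in
/-- The code of the order of `ℚ` restricted to `InSuborder x`. -/
noncomputable def suborderCode (x : ℕ → ℕ → ℕ) (a b : ℕ) : Bool :=
  decide (InSuborder x a ∧ InSuborder x b ∧ ratEnum a ≤ ratEnum b)

lemma suborderCode_eq_true {x : ℕ → ℕ → ℕ} {a b : ℕ} :
    suborderCode x a b = true ↔ InSuborder x a ∧ InSuborder x b ∧ ratEnum a ≤ ratEnum b := by
  simp [suborderCode]

lemma suborderCode_self {x : ℕ → ℕ → ℕ} {a : ℕ} :
    suborderCode x a a = true ↔ InSuborder x a := by
  simp [suborderCode]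

lemma isClopen_inSuborder (a : ℕ) : IsClopen {x | InSuborder x a} := by
  have h : {x | InSuborder x a} = {_x : ℕ → ℕ → ℕ | (⌊ratEnum a⌋ : ℚ) = ratEnum a} ∪
      ⋃ k ∈ Finset.range a, (fun x : ℕ → ℕ → ℕ => x ⌊ratEnum a⌋.toNat k) ⁻¹' {0}ᶜ := by
    ext x
    simp [InSuborder]
  rw [h]
  refine IsClopen.union ⟨isClosed_const, isOpen_const⟩ ?_
  exact isClopen_biUnion_finset fun k _ =>
    (isClopen_discrete _).preimage (continuous_apply_apply _ _)

lemma continuous_suborderCode : Continuous suborderCode := by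
  refine continuous_pi fun a => continuous_pi fun b => ?_
  rw [continuous_bool_rng true]
  have h : (fun x => suborderCode x a b) ⁻¹' {true} = {x | InSuborder x a} ∩
      ({x | InSuborder x b} ∩ {_x | ratEnum a ≤ ratEnum b}) := by
    ext x
    simp [suborderCode_eq_true]
  rw [h]
  exact (isClopen_inSuborder a).inter
    ((isClopen_inSuborder b).inter ⟨isClosed_const, isOpen_const⟩)

lemma isLinearOrderCode_suborderCode (x : ℕ → ℕ → ℕ) :
    IsLinearOrderCode (suborderCode x) := by
  simp only [IsLinearOrderCode, suborderCode_self]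
  simp only [suborderCode_eq_true]
  refine ⟨fun _ h => h, fun a b _ _ hab hba => ?_, fun a b c ha _ hc hab hbc => ?_,
    fun a b ha hb => ?_⟩
  · exact ratEnum.injective (le_antisymm hab.2.2 hba.2.2)
  · exact ⟨ha, hc, hab.2.2.trans hbc.2.2⟩
  · exact (le_total (ratEnum a) (ratEnum b)).imp (⟨ha, hb, ·⟩) (⟨hb, ha, ·⟩)

/-- If `x n` is zero, then `n` and `n + 1` are adjacent in the suborder attached to `x`. -/
lemma nonDenseW_of_truthW {n : ℕ} {x : ℕ → ℕ → ℕ} (h : TruthW n x) :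
    NonDenseW (ratEnum.symm n, ratEnum.symm (n + 1)) (suborderCode x) := by
  have h₀ : InSuborder x (ratEnum.symm n) := by simp [InSuborder]
  have h₁ : InSuborder x (ratEnum.symm (n + 1)) := by simp [InSuborder]
  simp only [NonDenseW, suborderCode_self]
  simp only [suborderCode_eq_true, Equiv.apply_symm_apply]
  refine ⟨h₀, h₁, ⟨h₀, h₁, by linarith⟩, fun e => ?_, fun c hc => ?_⟩
  · have := ratEnum.symm.injective e
    linarith
  · by_contra! hcon
    have hl := hcon.1 hc h₀
    have hr := hcon.2 h₁ hc
    have hfl : ⌊ratEnum c⌋ = n := Int.floor_eq_iff.2 ⟨by exact_mod_cast hl.le, by exact_mod_cast hr⟩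
    rcases hc with hc | ⟨k, -, hk⟩
    · rw [hfl] at hc
      rw [← hc] at hl
      simp at hl
    · rw [hfl, Int.toNat_natCast, h] at hk
      exact hk rfl

/-- A nonempty open interval of rationals contains a rational with arbitrarily large code. -/
lemma exists_ratEnum_mem_Ioo {p q : ℚ} (h : p < q) (k : ℕ) :
    ∃ c, k < c ∧ ratEnum c ∈ Set.Ioo p q := by
  have hinf : (ratEnum ⁻¹' Set.Ioo p q).Infinite :=
    (Set.Ioo_infinite h).preimage (by simp)
  obtain ⟨c, hc, hk⟩ := hinf.exists_gt k
  exact ⟨c, hk, hc⟩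

/-- An adjacent pair in the suborder attached to `x` can only occur over a zero sequence. -/
lemma truthW_of_nonDenseW {w : ℕ × ℕ} {x : ℕ → ℕ → ℕ} (h : NonDenseW w (suborderCode x)) :
    TruthW ⌊ratEnum w.1⌋.toNat x := by
  obtain ⟨a, b⟩ := w
  simp only [NonDenseW, suborderCode_self] at h
  simp only [suborderCode_eq_true] at h
  obtain ⟨-, -, ⟨-, -, hab⟩, hne, hgap⟩ := h
  by_contra hx
  obtain ⟨k, hk⟩ := Function.ne_iff.1 hx
  have hlt : ratEnum a < min (ratEnum b) (⌊ratEnum a⌋ + 1) :=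
    lt_min (lt_of_le_of_ne hab (ratEnum.injective.ne hne)) (Int.lt_floor_add_one _)
  obtain ⟨c, hkc, hac, hcb⟩ := exists_ratEnum_mem_Ioo hlt k
  obtain ⟨hcb, hcf⟩ := lt_min_iff.1 hcb
  have hfl : ⌊ratEnum c⌋ = ⌊ratEnum a⌋ :=
    Int.floor_eq_iff.2 ⟨(Int.floor_le _).trans hac.le, hcf⟩
  have hc : InSuborder x c := Or.inr ⟨k, Finset.mem_range.2 hkc, by rwa [hfl]⟩
  rcases hgap c hc with h | h
  · exact absurd h.2.2 hac.not_ge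
  · exact absurd h.2.2 hcb.not_ge

/-- `Truth` is many-one (Levin) reducible to `NonDense` via a reduction whose
values always code linear orders; hence `NonDense` is Σ⁰₂-complete. -/
theorem truth_manyOneRed_nonDense :
    ∃ (φ : (ℕ → ℕ → ℕ) → (ℕ → ℕ → Bool)) (rm : ℕ × (ℕ → ℕ → ℕ) → ℕ × ℕ)
      (rp : (ℕ × ℕ) × (ℕ → ℕ → ℕ) → ℕ),
      Continuous φ ∧
      (∀ x, IsLinearOrderCode (φ x)) ∧
      ContinuousOn rm {p : ℕ × (ℕ → ℕ → ℕ) | TruthW p.1 p.2} ∧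
      ContinuousOn rp
        {p : (ℕ × ℕ) × (ℕ → ℕ → ℕ) | (∃ n, TruthW n p.2) ∧ NonDenseW p.1 (φ p.2)} ∧
      (∀ x, (∃ n, TruthW n x) ↔ (∃ w, NonDenseW w (φ x))) ∧
      (∀ n x, TruthW n x → NonDenseW (rm (n, x)) (φ x)) ∧
      (∀ w x, (∃ n, TruthW n x) → NonDenseW w (φ x) → TruthW (rp (w, x)) x) := by
  refine ⟨suborderCode, fun p => (ratEnum.symm p.1, ratEnum.symm (p.1 + 1)),
    fun p => ⌊ratEnum p.1.1⌋.toNat, continuous_suborderCode, isLinearOrderCode_suborderCode,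
    ?_, ?_, ?_, fun n x => nonDenseW_of_truthW, fun w x _ => truthW_of_nonDenseW⟩
  · exact ((continuous_of_discreteTopology (f := fun n : ℕ =>
      (ratEnum.symm n, ratEnum.symm ((n : ℚ) + 1)))).comp continuous_fst).continuousOn
  · exact ((continuous_of_discreteTopology (f := fun w : ℕ × ℕ =>
      ⌊ratEnum w.1⌋.toNat)).comp continuous_fst).continuousOn
  · exact fun x => ⟨fun ⟨_, h⟩ => ⟨_, nonDenseW_of_truthW h⟩,
      fun ⟨_, h⟩ => ⟨_, truthW_of_nonDenseW h⟩⟩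
end

section
/- Truth is many-one (Levin) reducible to Tr₂(≥2): Truth ≤ₘ Tr₂(≥2). Consequently Tr₂(≥2) is many-one (Levin) complete among Σ⁰₂ witnessed subsets. -/
/-- Binary tree codes: prefix-closed subsets of `List Bool`. -/
abbrev TreeCode :=
  {t : List Bool → Bool // ∀ σ τ : List Bool, t σ = true → τ <+: σ → t τ = true}

/-- `p` is an infinite path through the tree coded by `t`. -/
def IsPathOf (p : ℕ → Bool) (t : TreeCode) : Prop :=
  ∀ n : ℕ, t.val (List.ofFn fun i : Fin n => p i) = true

/-- A string is extendible in a tree if some infinite path extends it. -/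
def Extendible (t : TreeCode) (σ : List Bool) : Prop :=
  ∃ p : ℕ → Bool, IsPathOf p t ∧ List.ofFn (fun i : Fin σ.length => p i) = σ

/-- The witnessed set `Tr₂(≥2)` of binary trees with at least two infinite paths,
witnessed by a pair of incomparable extendible strings. -/
def Tr2ge2W (w : List Bool × List Bool) (t : TreeCode) : Prop :=
  ¬ w.1 <+: w.2 ∧ ¬ w.2 <+: w.1 ∧ Extendible t w.1 ∧ Extendible t w.2

/-- The topology on finite lists over a discrete space is discrete. -/
theorem List.discreteTopology {α : Type*} [TopologicalSpace α] [DiscreteTopology α] :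
    DiscreteTopology (List α) := by
  rw [discreteTopology_iff_nhds]
  intro l
  induction l with
  | nil => exact nhds_nil
  | cons a l ih =>
    rw [nhds_cons, ih, nhds_discrete]
    simp

/-- Condition for a string `σ` to lie in the tree attached to `x`: `σ` has at most one entry
`true`, and if this entry is at position `i` then the part of `σ` after it is no longer than
the initial run of zeros of `x i`. -/
def InCombTree (x : ℕ → ℕ → ℕ) (σ : List Bool) : Prop :=
  ∀ i j : ℕ, σ[i]? = some true → i + 1 + j < σ.length →
    σ[i + 1 + j]? = some false ∧ x i j = 0

theorem InCombTree.of_prefix {x : ℕ → ℕ → ℕ} {σ τ : List Bool} (h : InCombTree x σ)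
    (hτ : τ <+: σ) : InCombTree x τ := by
  obtain ⟨ρ, rfl⟩ := hτ
  intro i j hi hj
  have := h i j (by rw [List.getElem?_append_left (by omega)]; exact hi)
    (by rw [List.length_append]; omega)
  rwa [List.getElem?_append_left hj] at this

open Classical in
/-- The tree attached to `x`: it contains the all-`false` path, and for each `n` a side branch
leaving it at height `n`, which is infinite exactly when `x n` is the zero sequence. -/
noncomputable def combTree (x : ℕ → ℕ → ℕ) : TreeCode :=
  ⟨fun σ => decide (InCombTree x σ), fun σ τ hσ hτ => by
    rw [decide_eq_true_eq] at hσ ⊢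
    exact hσ.of_prefix hτ⟩

theorem combTree_eq_true_iff {x : ℕ → ℕ → ℕ} {σ : List Bool} :
    (combTree x).val σ = true ↔ InCombTree x σ := by
  simp [combTree]

theorem isClopen_setOf_inCombTree (σ : List Bool) : IsClopen {x | InCombTree x σ} := by
  have h : {x | InCombTree x σ} = ⋂ i ∈ Finset.range σ.length, ⋂ j ∈ Finset.range σ.length,
      (fun x : ℕ → ℕ → ℕ => x i j) ⁻¹' {k | σ[i]? = some true → i + 1 + j < σ.length →
        σ[i + 1 + j]? = some false ∧ k = 0} := by
    ext x
    simp only [InCombTree, Set.mem_ofPred_eq, Set.mem_iInter, Finset.mem_range, Set.mem_preimage]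
    exact ⟨fun h i _ j _ => h i j,
      fun h i j hi hj => h i (by omega) j (by omega) hi hj⟩
  rw [h]
  exact isClopen_biInter_finset fun i _ => isClopen_biInter_finset fun j _ =>
    (isClopen_discrete _).preimage (by fun_prop)

theorem continuous_combTree : Continuous combTree := by
  refine Continuous.subtype_mk (continuous_pi fun σ => ?_) _
  rw [continuous_bool_rng true]
  convert isClopen_setOf_inCombTree σ using 1
  ext x
  simp

theorem isPathOf_combTree_iff {x : ℕ → ℕ → ℕ} {p : ℕ → Bool} :
    IsPathOf p (combTree x) ↔
      ∀ i j : ℕ, p i = true → p (i + 1 + j) = false ∧ x i j = 0 := by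
  simp only [IsPathOf, combTree_eq_true_iff, InCombTree, List.length_ofFn]
  constructor
  · intro h i j hi
    have hlt : i < i + 1 + j + 1 := by omega
    have := h (i + 1 + j + 1) i j (by simp [hi, hlt, -List.ofFn_succ])
      (by omega)
    simpa [List.getElem?_ofFn, -List.ofFn_succ] using this
  · intro h n i j hi hj
    have hin : i < n := by omega
    have hi' : p i = true := by simpa [List.getElem?_ofFn, hin] using hi
    simpa [List.getElem?_ofFn, hj] using h i j hi'

/-- An extendible string of `combTree x` whose first `true` is at `n` shows `x n = 0`. -/
theorem Extendible.truthW_idxOf {x : ℕ → ℕ → ℕ} {σ : List Bool}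
    (h : Extendible (combTree x) σ) (hσ : true ∈ σ) : TruthW (σ.idxOf true) x := by
  obtain ⟨p, hp, hpσ⟩ := h
  rw [isPathOf_combTree_iff] at hp
  have hlt : σ.idxOf true < σ.length := List.idxOf_lt_length_iff.2 hσ
  have hget : p (σ.idxOf true) = true := by
    have h1 : σ[σ.idxOf true]? = some true := by
      rw [List.getElem?_eq_getElem hlt, List.getElem_idxOf]
    rw [← hpσ, List.getElem?_ofFn] at h1
    simp only [hpσ] at h1
    simpa [hlt] using h1
  exact funext fun j => (hp _ j hget).2

theorem List.prefix_or_prefix_of_true_notMem {σ τ : List Bool} (hσ : true ∉ σ) (hτ : true ∉ τ) :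
    σ <+: τ ∨ τ <+: σ := by
  have key : ∀ ρ : List Bool, true ∉ ρ → ρ = List.replicate ρ.length false := fun ρ hρ =>
    List.eq_replicate_iff.2 ⟨rfl, fun b hb => by cases b <;> simp_all⟩
  rw [key σ hσ, key τ hτ]
  simp only [List.prefix_replicate_iff, List.length_replicate, and_true]
  exact le_total _ _

/-- The branching index read off from a pair of strings. -/
def branchIndex (v : List Bool × List Bool) : ℕ :=
  if true ∈ v.1 then v.1.idxOf true else v.2.idxOf true

theorem Tr2ge2W.truthW_branchIndex {x : ℕ → ℕ → ℕ} {v : List Bool × List Bool}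
    (h : Tr2ge2W v (combTree x)) : TruthW (branchIndex v) x := by
  obtain ⟨h1, h2, e1, e2⟩ := h
  unfold branchIndex
  split_ifs with hv
  · exact e1.truthW_idxOf hv
  · refine e2.truthW_idxOf ?_
    by_contra hv'
    exact (List.prefix_or_prefix_of_true_notMem hv hv').elim h1 h2

/-- The pair of strings of length `n + 1` separating the `n`-th side branch from the all-`false`
path. -/
def branchPair (n : ℕ) : List Bool × List Bool :=
  (List.ofFn fun i : Fin (n + 1) => decide ((i : ℕ) = n), List.ofFn fun _ : Fin (n + 1) => false)

theorem extendible_ofFn {t : TreeCode} {p : ℕ → Bool} (hp : IsPathOf p t) (n : ℕ) :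
    Extendible t (List.ofFn fun i : Fin n => p i) := by
  refine ⟨p, hp, List.ext_getElem (by simp) ?_⟩
  simp

theorem TruthW.tr2ge2W_branchPair {n : ℕ} {x : ℕ → ℕ → ℕ} (h : TruthW n x) :
    Tr2ge2W (branchPair n) (combTree x) := by
  have hne : (branchPair n).1 ≠ (branchPair n).2 := fun he => by
    have := congrFun (List.ofFn_injective he) (Fin.last n)
    simp at this
  have hlen : (branchPair n).1.length = (branchPair n).2.length := by simp [branchPair]
  refine ⟨fun hp => hne (hp.eq_of_length hlen), fun hp => hne (hp.eq_of_length hlen.symm).symm,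
    extendible_ofFn (p := fun i => decide (i = n)) (isPathOf_combTree_iff.2 ?_) _,
    extendible_ofFn (p := fun _ => false) (isPathOf_combTree_iff.2 ?_) _⟩
  · intro i j hi
    obtain rfl : i = n := by simpa using hi
    exact ⟨by simp; omega, congrFun h j⟩
  · simp

/-- `Truth` is many-one (Levin) reducible to `Tr₂(≥2)`; hence `Tr₂(≥2)` is
many-one (Levin) complete among Σ⁰₂ witnessed subsets. -/
theorem truth_manyOneRed_tr2ge2 : ManyOneRed TruthW Tr2ge2W := by
  have : DiscreteTopology (List Bool) := List.discreteTopology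
  refine ⟨combTree, fun q => branchPair q.1, fun q => branchIndex q.1, continuous_combTree,
    ((continuous_of_discreteTopology (f := branchPair)).comp continuous_fst).continuousOn,
    ((continuous_of_discreteTopology (f := branchIndex)).comp continuous_fst).continuousOn,
    fun x => ⟨fun ⟨n, hn⟩ => ⟨_, hn.tr2ge2W_branchPair⟩,
      fun ⟨v, hv⟩ => ⟨_, hv.truthW_branchIndex⟩⟩,
    fun n x h => TruthW.tr2ge2W_branchPair h, fun v x _ h => Tr2ge2W.truthW_branchIndex h⟩
end
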